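/- arXiv:2511.09230 — 3 statements merged into one kernel-verified Lean document; each statement's English description precedes it below -/
import Mathlib

section
/- For every k ≥ 2 and n = 2^k, there exists a Hamiltonian path P in the hypercube Q_n together with an (n−1)-run partition of its flip sequence whose parameters satisfy: ν = 6 and λ = 8 if k = 2, and ν = (17/8)·(2^n/n) − 4 and λ = 2^n − (25/8)·(2^n/n) + 4 if k ≥ 3. -/
open scoped symmDiff

/-- A Hamiltonian path in the hypercube `Q_n` (vertices: subsets of `[n] = {1,…,n}`,
edges: pairs of subsets whose symmetric difference is a singleton), given as the list
of its `2^n` vertices. -/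
def IsHamPath (n : ℕ) (l : List (Finset ℕ)) : Prop :=
  (∀ s ∈ l, s ⊆ Finset.Icc 1 n) ∧ l.Nodup ∧ l.length = 2 ^ n ∧
    l.Chain' (fun s t => ∃ d, s ∆ t = {d})

/-- The flip sequence of a path: the directions of its consecutive edges
(the direction of an edge is the unique element of the symmetric difference of its
endpoints, here obtained as the sum of the elements of that singleton). -/
def flipSeq (l : List (Finset ℕ)) : List ℕ :=
  (l.zip l.tail).map (fun p => (p.1 ∆ p.2).sum id)

/-- A block of type (a) for a `ρ`-run partition: a nonempty block, all of whose entries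
are `≤ ρ`, whose consecutive entries increase by exactly `1` throughout or decrease by
exactly `1` throughout (a single entry `≤ ρ` qualifies). -/
def IsRunBlock (ρ : ℕ) (b : List ℕ) : Prop :=
  b ≠ [] ∧ (∀ a ∈ b, a ≤ ρ) ∧
    (b.Chain' (fun p q => q = p + 1) ∨ b.Chain' (fun p q => p = q + 1))

/-- A `ρ`-run partition of a sequence `σ`: a decomposition of `σ` into contiguous
blocks, each being either a run (type (a)) or a singleton block whose entry
exceeds `ρ` (type (b)). -/
def IsRunPartition (ρ : ℕ) (σ : List ℕ) (bs : List (List ℕ)) : Prop :=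
  bs.flatten = σ ∧ ∀ b ∈ bs, IsRunBlock ρ b ∨ ∃ a, ρ < a ∧ b = [a]

/-- The blocks of type (a) (in a valid `ρ`-run partition these are exactly the blocks
all of whose entries are `≤ ρ`). -/
def runBlocks (ρ : ℕ) (bs : List (List ℕ)) : List (List ℕ) :=
  bs.filter (fun b => b.all (fun a => decide (a ≤ ρ)))

/-- `ν`: the number of blocks of type (a). -/
def runNu (ρ : ℕ) (bs : List (List ℕ)) : ℕ := (runBlocks ρ bs).length

/-- `λ`: the sum over all blocks of type (a) of (block length − 1). -/
def runLambda (ρ : ℕ) (bs : List (List ℕ)) : ℕ :=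
  ((runBlocks ρ bs).map (fun b => b.length - 1)).sum

section Walks

/-- The closed-up vertex list of the walk starting at `x` and flipping the absolute values
of the letters of a word: the vertex from which each letter departs. -/
def walk : Finset ℕ → List ℤ → List (Finset ℕ)
  | _, [] => []
  | x, a :: l => x :: walk (x ∆ {a.natAbs}) l

/-- The final vertex of the walk starting at `x` along a word. -/
def walkEnd (x : Finset ℕ) (l : List ℤ) : Finset ℕ :=
  l.foldl (fun y a => y ∆ {a.natAbs}) x

@[simp] theorem walkEnd_nil (x : Finset ℕ) : walkEnd x [] = x := rfl

@[simp] theorem walkEnd_cons (x : Finset ℕ) (a : ℤ) (l : List ℤ) :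
    walkEnd x (a :: l) = walkEnd (x ∆ {a.natAbs}) l := rfl

@[simp] theorem walkEnd_append (x : Finset ℕ) (l m : List ℤ) :
    walkEnd x (l ++ m) = walkEnd (walkEnd x l) m := by
  simp [walkEnd]

theorem walk_append (x : Finset ℕ) (l m : List ℤ) :
    walk x (l ++ m) = walk x l ++ walk (walkEnd x l) m := by
  induction l generalizing x with
  | nil => rfl
  | cons a l ih => simp [walk, ih]

theorem walk_concat (x : Finset ℕ) (l : List ℤ) (a b : ℤ) :
    walk x (l ++ [a]) = walk x (l ++ [b]) := by
  simp [walk_append, walk]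

@[simp] theorem length_walk (x : Finset ℕ) (l : List ℤ) : (walk x l).length = l.length := by
  induction l generalizing x with
  | nil => rfl
  | cons a l ih => simp [walk, ih]

theorem walk_symmDiff (x g : Finset ℕ) (l : List ℤ) :
    walk (x ∆ g) l = (walk x l).map (· ∆ g) := by
  induction l generalizing x with
  | nil => rfl
  | cons a l ih => simp [walk, symmDiff_right_comm x g, ih]

theorem walkEnd_symmDiff (x g : Finset ℕ) (l : List ℤ) :
    walkEnd (x ∆ g) l = walkEnd x l ∆ g := by
  induction l generalizing x with
  | nil => rfl
  | cons a l ih => simp [symmDiff_right_comm x g, ih]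

theorem symmDiff_singleton_subset {x s : Finset ℕ} {a : ℕ} (hx : x ⊆ s) (ha : a ∈ s) :
    x ∆ {a} ⊆ s := by
  intro b hb
  rw [Finset.mem_symmDiff, Finset.mem_singleton] at hb
  rcases hb with hb | hb
  · exact hx hb.1
  · exact hb.1 ▸ ha

theorem walkEnd_subset {s x : Finset ℕ} {l : List ℤ} (hx : x ⊆ s)
    (hl : ∀ a ∈ l, a.natAbs ∈ s) : walkEnd x l ⊆ s := by
  induction l generalizing x with
  | nil => exact hx
  | cons a l ih =>
    rw [List.forall_mem_cons] at hl
    exact ih (symmDiff_singleton_subset hx hl.1) hl.2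

theorem subset_of_mem_walk {s x : Finset ℕ} {l : List ℤ} (hx : x ⊆ s)
    (hl : ∀ a ∈ l, a.natAbs ∈ s) : ∀ y ∈ walk x l, y ⊆ s := by
  induction l generalizing x with
  | nil => simp [walk]
  | cons a l ih =>
    rw [List.forall_mem_cons] at hl
    simp only [walk, List.forall_mem_cons]
    exact ⟨hx, ih (symmDiff_singleton_subset hx hl.1) hl.2⟩

theorem isChain_walk (x : Finset ℕ) (l : List ℤ) :
    (walk x l).IsChain (fun s t => ∃ d, s ∆ t = {d}) := by
  induction l generalizing x with
  | nil => exact .nil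
  | cons a l ih =>
    cases l with
    | nil => exact .singleton _
    | cons b l =>
      exact .cons_cons ⟨a.natAbs, symmDiff_symmDiff_cancel_left _ _⟩ (ih _)

theorem flipSeq_walk (x : Finset ℕ) (l : List ℤ) (a : ℤ) :
    flipSeq (walk x (l ++ [a])) = l.map Int.natAbs := by
  induction l generalizing x with
  | nil => rfl
  | cons b l ih =>
    have h := ih (x ∆ {b.natAbs})
    cases l with
    | nil => simp [walk, flipSeq, symmDiff_symmDiff_cancel_left]
    | cons c l =>
      simp only [List.cons_append, walk, flipSeq, List.tail_cons, List.zip_cons_cons,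
        List.map_cons, symmDiff_symmDiff_cancel_left, Finset.sum_singleton, id] at h ⊢
      rw [h]

theorem isHamPath_walk {n : ℕ} {x : Finset ℕ} {l : List ℤ} (hx : x ⊆ Finset.Icc 1 n)
    (hl : ∀ a ∈ l, a.natAbs ∈ Finset.Icc 1 n) (hnd : (walk x l).Nodup)
    (hlen : l.length = 2 ^ n) : IsHamPath n (walk x l) :=
  ⟨subset_of_mem_walk hx hl, hnd, by simpa using hlen, isChain_walk x l⟩

end Walks

section Syndrome

/-- The weight of a direction; below `n` it depends only on the 2-adic valuation. -/
def weight (n i : ℕ) : ℕ := if i < n then i ^^^ (i - 1) else 0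

/-- The XOR of the weights of the elements of a vertex. On `{1,…,e}` with `e < n`
it telescopes to `e`. -/
def syndrome (n : ℕ) (x : Finset ℕ) : ℕ := x.fold (· ^^^ ·) 0 (weight n)

theorem syndrome_insert {n a : ℕ} {x : Finset ℕ} (h : a ∉ x) :
    syndrome n (insert a x) = weight n a ^^^ syndrome n x :=
  Finset.fold_insert h

theorem syndrome_symmDiff_singleton (n a : ℕ) (x : Finset ℕ) :
    syndrome n (x ∆ {a}) = syndrome n x ^^^ weight n a := by
  by_cases h : a ∈ x
  · have h1 : x ∆ {a} = x.erase a := by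
      ext b; simp only [Finset.mem_symmDiff, Finset.mem_singleton, Finset.mem_erase]; grind
    have h2 := syndrome_insert (n := n) (Finset.notMem_erase a x)
    rw [Finset.insert_erase h] at h2
    rw [h1, h2, Nat.xor_comm (weight n a), Nat.xor_assoc, Nat.xor_self, Nat.xor_zero]
  · have h1 : x ∆ {a} = insert a x := by
      ext b; simp only [Finset.mem_symmDiff, Finset.mem_singleton, Finset.mem_insert]; grind
    rw [h1, syndrome_insert h, Nat.xor_comm]

theorem syndrome_symmDiff_pair {n e d : ℕ} (h : weight n e = weight n d) (x : Finset ℕ) :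
    syndrome n (x ∆ ({e} ∆ {d})) = syndrome n x := by
  rw [← symmDiff_assoc, syndrome_symmDiff_singleton, syndrome_symmDiff_singleton, h,
    Nat.xor_assoc, Nat.xor_self, Nat.xor_zero]

theorem Icc_symmDiff_succ (e : ℕ) : Finset.Icc 1 e ∆ {e + 1} = Finset.Icc 1 (e + 1) := by
  ext b
  simp only [Finset.mem_symmDiff, Finset.mem_singleton, Finset.mem_Icc]
  omega

theorem syndrome_Icc {n e : ℕ} (h : e < n) : syndrome n (Finset.Icc 1 e) = e := by
  induction e with
  | zero => rfl
  | succ e ih =>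
    rw [← Icc_symmDiff_succ, syndrome_symmDiff_singleton, ih (by omega), weight, if_pos h,
      Nat.add_sub_cancel, Nat.xor_comm (e + 1), ← Nat.xor_assoc, Nat.xor_self, Nat.zero_xor]

theorem weight_self (n : ℕ) : weight n n = 0 := by simp [weight]

theorem xor_pred_two_mul {m : ℕ} (hm : 0 < m) :
    (2 * m) ^^^ (2 * m - 1) = 2 * (m ^^^ (m - 1)) + 1 := by
  obtain ⟨m, rfl⟩ : ∃ t, m = t + 1 := ⟨m - 1, by omega⟩
  have := Nat.xor_bit false (m + 1) true m
  simp only [Nat.bit_val] at this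
  simpa [show 2 * (m + 1) - 1 = 2 * m + 1 by omega] using this

theorem xor_pred_odd (m : ℕ) : (2 * m + 1) ^^^ (2 * m) = 1 := by
  have := Nat.xor_bit true m false m
  simpa [Nat.bit_val] using this

theorem exists_two_pow_xor_pred_eq {d : ℕ} (hd : 0 < d) :
    ∃ j, 2 ^ j ≤ d ∧ (2 ^ j) ^^^ (2 ^ j - 1) = d ^^^ (d - 1) := by
  induction d using Nat.strong_induction_on with
  | _ d ih =>
    obtain ⟨m, rfl | rfl⟩ := Nat.even_or_odd' d
    · obtain ⟨j, hj, h⟩ := ih m (by omega) (by omega)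
      refine ⟨j + 1, by rw [pow_succ]; omega, ?_⟩
      rw [pow_succ', xor_pred_two_mul (by positivity), xor_pred_two_mul (by omega), h]
    · exact ⟨0, by omega, by simpa using (xor_pred_odd m).symm⟩

end Syndrome

section Cycles

/-- A word is the cyclic flip sequence of a cycle in `Q_n` on whose vertices the
coordinates in `U` are determined by the syndrome. -/
def IsCycleWord (n : ℕ) (U : Finset ℕ) (l : List ℤ) : Prop :=
  ∃ x ⊆ Finset.Icc 1 n, walkEnd x l = x ∧ (walk x l).Nodup ∧
    ∀ y ∈ walk x l, ∀ d ∈ U, (d ∈ y ↔ d ≤ syndrome n y)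

theorem IsCycleWord.rotate {n : ℕ} {U : Finset ℕ} {l m : List ℤ}
    (hlm : ∀ a ∈ l ++ m, a.natAbs ∈ Finset.Icc 1 n) (h : IsCycleWord n U (l ++ m)) :
    IsCycleWord n U (m ++ l) := by
  obtain ⟨x, hx, hend, hnd, hU⟩ := h
  rw [walkEnd_append] at hend
  have hperm : (walk (walkEnd x l) (m ++ l)).Perm (walk x (l ++ m)) := by
    rw [walk_append, walk_append, hend]
    exact List.perm_append_comm
  refine ⟨walkEnd x l, walkEnd_subset hx fun a ha => hlm a (by simp [ha]), ?_,
    hperm.nodup_iff.2 hnd, fun y hy => hU y (hperm.mem_iff.1 hy)⟩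
  rw [walkEnd_append, hend]

/-- Joining a cycle with its translate by `{e, d}` at an edge of direction `e`. -/
theorem IsCycleWord.double {n : ℕ} {U : Finset ℕ} {l : List ℤ} {e d : ℤ}
    (h : IsCycleWord n U (l ++ [e])) (hd : d.natAbs ∈ U) (he : e.natAbs ∉ U)
    (hw : weight n e.natAbs = weight n d.natAbs) :
    IsCycleWord n (U.erase d.natAbs) ((l ++ [d]) ++ (l ++ [d])) := by
  obtain ⟨x, hx, hend, hnd, hU⟩ := h
  set g : Finset ℕ := {e.natAbs} ∆ {d.natAbs} with hg
  have hne : d.natAbs ≠ e.natAbs := fun h => he (h ▸ hd)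
  have hmem : ∀ (y : Finset ℕ) (c : ℕ), c ≠ e.natAbs → c ≠ d.natAbs → (c ∈ y ∆ g ↔ c ∈ y) := by
    intro y c h1 h2
    simp [hg, Finset.mem_symmDiff, h1, h2]
  have hmem' : ∀ y : Finset ℕ, d.natAbs ∈ y ∆ g ↔ d.natAbs ∉ y := by
    intro y
    simp [hg, Finset.mem_symmDiff, hne]
  have hmid : walkEnd x (l ++ [d]) = x ∆ g := by
    simp only [walkEnd_append, walkEnd_cons, walkEnd_nil] at hend ⊢
    conv_rhs => rw [← hend, hg]
    rw [← symmDiff_assoc, symmDiff_symmDiff_cancel_right]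
  have hwalk : walk x ((l ++ [d]) ++ (l ++ [d])) =
      walk x (l ++ [e]) ++ (walk x (l ++ [e])).map (· ∆ g) := by
    rw [walk_append, hmid, walk_symmDiff, walk_concat x l d e]
  refine ⟨x, hx, ?_, ?_, ?_⟩
  · rw [walkEnd_append, hmid, walkEnd_symmDiff, hmid, symmDiff_symmDiff_cancel_right]
  · rw [hwalk, List.nodup_append']
    refine ⟨hnd, hnd.map (symmDiff_left_injective g), ?_⟩
    intro y hy hy'
    obtain ⟨z, hz, rfl⟩ := List.mem_map.1 hy'
    have h1 := hU _ hy _ hd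
    have h2 := hU _ hz _ hd
    rw [hmem', syndrome_symmDiff_pair hw] at h1
    tauto
  · intro y hy c hc
    rw [hwalk, List.mem_append] at hy
    obtain ⟨hcd, hcU⟩ := Finset.mem_erase.1 hc
    rcases hy with hy | hy
    · exact hU y hy c hcU
    · obtain ⟨z, hz, rfl⟩ := List.mem_map.1 hy
      rw [hmem z c (fun h => he (h ▸ hcU)) hcd, syndrome_symmDiff_pair hw]
      exact hU z hz c hcU

end Cycles

section Glue

/-- Two consecutive signed letters that may lie in a common run. -/
def Glued (n : ℕ) (a b : ℤ) : Prop := b = a + 1 ∧ a.natAbs < n ∧ b.natAbs < n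

instance (n : ℕ) (a b : ℤ) : Decidable (Glued n a b) := by unfold Glued; infer_instance

/-- The number of consecutive pairs of letters that may lie in a common run. -/
def glueCount (n : ℕ) : List ℤ → ℕ
  | [] => 0
  | [_] => 0
  | a :: b :: l => (if Glued n a b then 1 else 0) + glueCount n (b :: l)

theorem glueCount_cons_le (n : ℕ) (a : ℤ) (l : List ℤ) :
    glueCount n (a :: l) ≤ glueCount n l + 1 := by
  cases l <;> simp only [glueCount] <;> grind

theorem le_glueCount_cons (n : ℕ) (a : ℤ) (l : List ℤ) :
    glueCount n l ≤ glueCount n (a :: l) := by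
  cases l <;> simp [glueCount]

theorem glueCount_cons_of_le {n : ℕ} {a : ℤ} (ha : n ≤ a.natAbs) (l : List ℤ) :
    glueCount n (a :: l) = glueCount n l := by
  cases l with
  | nil => rfl
  | cons b l => simp [glueCount, Glued, ha.not_gt]

theorem glueCount_add_le (n : ℕ) (l m : List ℤ) :
    glueCount n l + glueCount n m ≤ glueCount n (l ++ m) := by
  induction l with
  | nil => simp [glueCount]
  | cons a l ih =>
    cases l with
    | nil => simpa [glueCount] using le_glueCount_cons n a m
    | cons b l => simp only [List.cons_append, glueCount] at ih ⊢; omega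

theorem glueCount_append_cons_le (n : ℕ) (l m : List ℤ) (a : ℤ) :
    glueCount n (l ++ a :: m) ≤ glueCount n l + glueCount n m + 2 := by
  induction l with
  | nil => have := glueCount_cons_le n a m; simp [glueCount]; omega
  | cons b l ih =>
    cases l with
    | nil =>
      have h1 := glueCount_cons_le n a m
      have h2 := glueCount_cons_le n b (a :: m)
      simp only [List.cons_append, List.nil_append, glueCount] at *
      omega
    | cons c l => simp only [List.cons_append, glueCount] at ih ⊢; omega

theorem glueCount_append_cons_of_le {n : ℕ} {a : ℤ} (ha : n ≤ a.natAbs) (l m : List ℤ) :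
    glueCount n (l ++ a :: m) = glueCount n l + glueCount n m := by
  induction l with
  | nil => simp [glueCount, glueCount_cons_of_le ha]
  | cons b l ih =>
    cases l with
    | nil => simp [glueCount, glueCount_cons_of_le ha, Glued, ha.not_gt]
    | cons c l => simp only [List.cons_append, glueCount] at ih ⊢; omega

theorem exists_blocks {n : ℕ} (l : List ℤ) (t : ℕ) (ht : t ≤ glueCount n l) :
    ∃ bs : List (List ℤ), bs.flatten = l ∧ (∀ b ∈ bs, b ≠ [] ∧ b.IsChain (Glued n)) ∧
      (bs.map (fun b => b.length - 1)).sum = t := by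
  induction l generalizing t with
  | nil => exact ⟨[], rfl, by simp, by simp [glueCount] at ht; simp [ht]⟩
  | cons a l ih =>
    by_cases h : t ≤ glueCount n l
    · obtain ⟨bs, h1, h2, h3⟩ := ih t h
      refine ⟨[a] :: bs, by simp [h1], ?_, by simpa using h3⟩
      rw [List.forall_mem_cons]
      exact ⟨⟨by simp, .singleton _⟩, h2⟩
    · obtain ⟨s, rfl⟩ : ∃ s, t = s + 1 := ⟨t - 1, by omega⟩
      have hle := glueCount_cons_le n a l
      obtain ⟨bs, h1, h2, h3⟩ := ih s (by omega)
      cases l with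
      | nil => simp [glueCount] at ht
      | cons b l =>
        have hg : Glued n a b := by
          by_contra hg
          simp only [glueCount, hg, if_false] at ht h
          omega
        cases bs with
        | nil => simp at h1
        | cons c bs =>
          rw [List.forall_mem_cons] at h2
          cases c with
          | nil => exact absurd rfl h2.1.1
          | cons z c =>
            simp only [List.flatten_cons, List.cons_append, List.cons.injEq] at h1
            obtain ⟨rfl, h1⟩ := h1
            refine ⟨(a :: z :: c) :: bs, by simp [h1], ?_, ?_⟩
            · rw [List.forall_mem_cons]
              exact ⟨⟨by simp, .cons_cons hg h2.1.2⟩, h2.2⟩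
            · simp only [List.map_cons, List.sum_cons, List.length_cons] at h3 ⊢
              omega

end Glue

section Partitions

theorem natAbs_lt_of_isChain_glued {n : ℕ} {a b : ℤ} {l : List ℤ}
    (h : (a :: b :: l).IsChain (Glued n)) : ∀ z ∈ a :: b :: l, z.natAbs < n := by
  induction l generalizing a b with
  | nil =>
    have := (List.isChain_cons_cons.1 h).1
    simp [this.2.1, this.2.2]
  | cons c l ih =>
    rw [List.isChain_cons_cons] at h
    rw [List.forall_mem_cons]
    exact ⟨h.1.2.1, ih h.2⟩

theorem isChain_natAbs_of_isChain_glued {n : ℕ} {l : List ℤ} (h0 : ∀ z ∈ l, z ≠ 0)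
    (h : l.IsChain (Glued n)) :
    (l.map Int.natAbs).IsChain (fun p q => q = p + 1) ∨
      (l.map Int.natAbs).IsChain (fun p q => p = q + 1) := by
  have key : ∀ l : List ℤ, (∀ z ∈ l, z ≠ 0) → l.IsChain (Glued n) →
      ((∀ z ∈ l, 0 < z) ∧ (l.map Int.natAbs).IsChain (fun p q => q = p + 1)) ∨
      ((∀ z ∈ l, z < 0) ∧ (l.map Int.natAbs).IsChain (fun p q => p = q + 1)) := by
    intro l
    induction l with
    | nil => simp
    | cons a l ih =>
      intro h0 h
      rw [List.forall_mem_cons] at h0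
      cases l with
      | nil => simpa using h0.1.lt_or_gt.symm
      | cons b l =>
        rw [List.isChain_cons_cons] at h
        obtain ⟨hab, -, -⟩ := h.1
        simp only [List.map_cons, List.isChain_cons_cons, List.forall_mem_cons] at ih h0 ⊢
        rcases ih h0.2 h.2 with ⟨⟨h1, h2⟩, h3⟩ | ⟨⟨h1, h2⟩, h3⟩
        · exact Or.inl ⟨⟨by omega, h1, h2⟩, by omega, h3⟩
        · exact Or.inr ⟨⟨by omega, h1, h2⟩, by omega, h3⟩
  exact (key l h0 h).imp And.right And.right

/-- In a run partition every letter that is at most `ρ` is counted by `ν` or by `λ`. -/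
theorem runNu_add_runLambda {ρ : ℕ} {bs : List (List ℕ)}
    (h : ∀ b ∈ bs, IsRunBlock ρ b ∨ ∃ a, ρ < a ∧ b = [a]) :
    runNu ρ bs + runLambda ρ bs = bs.flatten.countP (fun a => decide (a ≤ ρ)) := by
  induction bs with
  | nil => rfl
  | cons b bs ih =>
    rw [List.forall_mem_cons] at h
    have ih := ih h.2
    simp only [runNu, runLambda, runBlocks] at ih ⊢
    rw [List.flatten_cons, List.countP_append, ← ih]
    rcases h.1 with hb | ⟨a, ha, rfl⟩
    · have hall : b.all (fun a => decide (a ≤ ρ)) = true := by simpa using hb.2.1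
      have hc : b.countP (fun a => decide (a ≤ ρ)) = b.length :=
        List.countP_eq_length.2 (by simpa using hb.2.1)
      have hpos := List.length_pos_of_ne_nil hb.1
      rw [List.filter_cons_of_pos (by simpa using hall), hc]
      simp only [List.length_cons, List.map_cons, List.sum_cons]
      omega
    · simp [ha]

theorem runLambda_eq_sum {ρ : ℕ} {bs : List (List ℕ)}
    (h : ∀ b ∈ bs, IsRunBlock ρ b ∨ ∃ a, ρ < a ∧ b = [a]) :
    runLambda ρ bs = (bs.map (fun b => b.length - 1)).sum := by
  induction bs with
  | nil => rfl
  | cons b bs ih =>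
    rw [List.forall_mem_cons] at h
    have ih := ih h.2
    simp only [runLambda, runBlocks] at ih ⊢
    rcases h.1 with hb | ⟨a, ha, rfl⟩
    · have hall : b.all (fun a => decide (a ≤ ρ)) = true := by simpa using hb.2.1
      rw [List.filter_cons_of_pos (by simpa using hall)]
      simp [ih]
    · simp [ha, ih]

theorem exists_runPartition {n : ℕ} (hn : 0 < n) {l : List ℤ} (h0 : ∀ z ∈ l, z ≠ 0) {t : ℕ}
    (ht : t ≤ glueCount n l) :
    ∃ bs : List (List ℕ), IsRunPartition (n - 1) (l.map Int.natAbs) bs ∧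
      runLambda (n - 1) bs = t ∧
      runNu (n - 1) bs + t + l.countP (fun z => decide (n ≤ z.natAbs)) = l.length := by
  obtain ⟨bs, rfl, h2, h3⟩ := exists_blocks l t ht
  have hb : ∀ b ∈ bs.map (List.map Int.natAbs),
      IsRunBlock (n - 1) b ∨ ∃ a, n - 1 < a ∧ b = [a] := by
    intro b hb
    obtain ⟨c, hc, rfl⟩ := List.mem_map.1 hb
    obtain ⟨hne, hch⟩ := h2 c hc
    have hdir := isChain_natAbs_of_isChain_glued
      (fun z hz => h0 z (List.mem_flatten.2 ⟨c, hc, hz⟩)) hch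
    match c, hne, hch, hdir with
    | [a], _, _, hdir =>
      by_cases ha : a.natAbs ≤ n - 1
      · exact Or.inl ⟨by simp, by simpa using ha, hdir⟩
      · exact Or.inr ⟨a.natAbs, by omega, rfl⟩
    | a :: b :: c, _, hch, hdir =>
      refine Or.inl ⟨by simp, ?_, hdir⟩
      intro p hp
      obtain ⟨z, hz, rfl⟩ := List.mem_map.1 hp
      have := natAbs_lt_of_isChain_glued hch z hz
      omega
  have hlam : runLambda (n - 1) (bs.map (List.map Int.natAbs)) = t := by
    rw [runLambda_eq_sum hb, ← h3, List.map_map]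
    congr 2
    ext c
    simp
  refine ⟨_, ⟨by rw [List.map_flatten], hb⟩, hlam, ?_⟩
  have hsum := runNu_add_runLambda hb
  rw [hlam, ← List.map_flatten, List.countP_map] at hsum
  rw [hsum, List.length_eq_countP_add_countP (fun z : ℤ => decide (z.natAbs ≤ n - 1))]
  congr 1
  refine List.countP_congr fun z _ => ?_
  simp
  omega

end Partitions

section Construction

/-- The ascending word `a+1, …, a+m`. -/
def ascWord : ℕ → ℕ → List ℤ
  | _, 0 => []
  | a, m + 1 => (a + 1 : ℕ) :: ascWord (a + 1) m

/-- The descending word `a+m, …, a+1`, with negative signs. -/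
def descWord (a : ℕ) : ℕ → List ℤ
  | 0 => []
  | m + 1 => -((a + m + 1 : ℕ) : ℤ) :: descWord a m

theorem descWord_succ (a m : ℕ) :
    descWord a (m + 1) = descWord (a + 1) m ++ [-((a + 1 : ℕ) : ℤ)] := by
  induction m with
  | zero => rfl
  | succ m ih =>
    rw [descWord, ih, descWord, List.cons_append]
    congr 3
    omega

@[simp] theorem length_ascWord (a m : ℕ) : (ascWord a m).length = m := by
  induction m generalizing a with
  | zero => rfl
  | succ m ih => simp [ascWord, ih]

@[simp] theorem length_descWord (a m : ℕ) : (descWord a m).length = m := by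
  induction m with
  | zero => rfl
  | succ m ih => simp [descWord, ih]

theorem mem_ascWord {a m : ℕ} {z : ℤ} : z ∈ ascWord a m ↔ (a : ℤ) < z ∧ z ≤ a + m := by
  induction m generalizing a with
  | zero => simp [ascWord]
  | succ m ih =>
    simp only [ascWord, List.mem_cons, ih]
    push_cast
    omega

theorem mem_descWord {a m : ℕ} {z : ℤ} : z ∈ descWord a m ↔ (a : ℤ) < -z ∧ -z ≤ a + m := by
  induction m with
  | zero => simp [descWord]
  | succ m ih =>
    simp only [descWord, List.mem_cons, ih]
    push_cast
    omega

theorem le_glueCount_ascWord {n a m : ℕ} (h : a + m < n) :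
    m ≤ glueCount n (ascWord a m) + 1 := by
  induction m generalizing a with
  | zero => omega
  | succ m ih =>
    have ih := ih (a := a + 1) (by omega)
    cases m with
    | zero => omega
    | succ m =>
      simp only [ascWord, glueCount] at ih ⊢
      rw [if_pos ⟨by push_cast; omega, by omega, by omega⟩]
      omega

theorem le_glueCount_descWord {n a m : ℕ} (h : a + m < n) :
    m ≤ glueCount n (descWord a m) + 1 := by
  induction m with
  | zero => omega
  | succ m ih =>
    have ih := ih (by omega)
    cases m with
    | zero => omega
    | succ m =>
      simp only [descWord, glueCount] at ih ⊢
      rw [if_pos ⟨by push_cast; omega, by omega, by omega⟩]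
      omega

theorem walk_ascWord (a m : ℕ) (c : ℤ) :
    walk (Finset.Icc 1 a) (ascWord a m ++ [c]) =
      (List.range' a (m + 1)).map (fun e => Finset.Icc 1 e) := by
  induction m generalizing a with
  | zero => rfl
  | succ m ih =>
    rw [ascWord, List.cons_append, walk, Int.natAbs_natCast, Icc_symmDiff_succ, ih,
      List.range'_succ (n := m + 1), List.map_cons]

theorem walkEnd_ascWord (a m : ℕ) :
    walkEnd (Finset.Icc 1 a) (ascWord a m) = Finset.Icc 1 (a + m) := by
  induction m generalizing a with
  | zero => rfl
  | succ m ih =>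
    rw [ascWord, walkEnd_cons, Int.natAbs_natCast, Icc_symmDiff_succ, ih]
    congr 1
    omega

theorem walk_descWord (m : ℕ) (c : ℤ) :
    walk (Finset.Icc 1 m) (descWord 0 m ++ [c]) =
      (List.range (m + 1)).reverse.map (fun e => Finset.Icc 1 e) := by
  induction m with
  | zero => rfl
  | succ m ih =>
    rw [descWord, List.cons_append, walk, Int.natAbs_neg, Int.natAbs_natCast, zero_add,
      ← Icc_symmDiff_succ, symmDiff_symmDiff_cancel_right, ih, List.range_succ (n := m + 1)]
    simp [Icc_symmDiff_succ]

theorem walkEnd_descWord (m : ℕ) : walkEnd (Finset.Icc 1 m) (descWord 0 m) = ∅ := by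
  induction m with
  | zero => rfl
  | succ m ih =>
    rw [descWord, walkEnd_cons, Int.natAbs_neg, Int.natAbs_natCast, zero_add,
      ← Icc_symmDiff_succ, symmDiff_symmDiff_cancel_right, ih]

theorem isCycleWord_ascWord_descWord {n : ℕ} (hn : 0 < n) {U : Finset ℕ}
    (hU : U ⊆ Finset.Ico 1 n) :
    IsCycleWord n U ((ascWord 0 (n - 1) ++ [(n : ℤ)]) ++ (descWord 0 (n - 1) ++ [(n : ℤ)])) := by
  have hmid : walkEnd ∅ (ascWord 0 (n - 1) ++ [(n : ℤ)]) = Finset.Icc 1 (n - 1) ∆ {n} := by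
    have := walkEnd_ascWord 0 (n - 1)
    simp only [zero_add, Finset.Icc_eq_empty_of_lt zero_lt_one] at this
    simp [this]
  have hwalk : walk ∅ ((ascWord 0 (n - 1) ++ [(n : ℤ)]) ++ (descWord 0 (n - 1) ++ [(n : ℤ)])) =
      (List.range n).map (fun e => Finset.Icc 1 e) ++
      ((List.range n).reverse.map (fun e => Finset.Icc 1 e)).map (· ∆ {n}) := by
    have h1 := walk_ascWord 0 (n - 1) n
    rw [Finset.Icc_eq_empty_of_lt zero_lt_one, ← List.range_eq_range', Nat.sub_add_cancel hn] at h1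
    rw [walk_append, hmid, walk_symmDiff, walk_descWord, h1, Nat.sub_add_cancel hn]
  have hinj : ∀ a ∈ List.range n, ∀ b ∈ List.range n,
      Finset.Icc 1 a = Finset.Icc 1 b → a = b := by
    intro a _ b _ h
    simpa using congrArg Finset.card h
  have hnd : ((List.range n).map (fun e => Finset.Icc 1 e)).Nodup :=
    List.nodup_range.map_on hinj
  refine ⟨∅, Finset.empty_subset _, ?_, ?_, ?_⟩
  · rw [walkEnd_append, hmid, walkEnd_symmDiff, walkEnd_append, walkEnd_descWord]
    simp
  · rw [hwalk, List.nodup_append', List.map_reverse, List.map_reverse, List.nodup_reverse]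
    refine ⟨hnd, hnd.map (symmDiff_left_injective _), ?_⟩
    intro y hy hy'
    simp only [List.mem_map, List.mem_reverse, List.mem_range] at hy hy'
    obtain ⟨a, ha, rfl⟩ := hy
    obtain ⟨_, ⟨b, hb, rfl⟩, h⟩ := hy'
    have := congrArg (n ∈ ·) h
    simp [Finset.mem_symmDiff, ha.not_ge, hb.not_ge] at this
  · intro y hy d hd
    have hd := Finset.mem_Ico.1 (hU hd)
    simp only [hwalk, List.mem_append, List.mem_map, List.mem_reverse, List.mem_range] at hy
    rcases hy with ⟨a, ha, rfl⟩ | ⟨_, ⟨a, ha, rfl⟩, rfl⟩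
    · rw [syndrome_Icc ha, Finset.mem_Icc]
      omega
    · rw [syndrome_symmDiff_singleton, weight_self, Nat.xor_zero, syndrome_Icc ha,
        Finset.mem_symmDiff, Finset.mem_Icc, Finset.mem_singleton]
      omega

/-- The part of the initial cycle between its two flips of direction `1`. -/
def coreWord (n : ℕ) : List ℤ := ascWord 1 (n - 2) ++ (n : ℤ) :: descWord 1 (n - 2)

/-- The cycle word with four cores, of which one is preceded by a flip of direction `1`. -/
def quadWord (n : ℕ) : List ℤ :=
  coreWord n ++ [3, (n : ℤ), 5] ++ (coreWord n ++ [3, (n : ℤ)]) ++ (1 :: coreWord n) ++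
    [3, (n : ℤ), 5] ++ (coreWord n ++ [3, (n : ℤ), 7])

theorem length_coreWord {n : ℕ} (hn : 2 ≤ n) : (coreWord n).length = 2 * n - 3 := by
  simp [coreWord]; omega

theorem natAbs_of_mem_coreWord {n : ℕ} (hn : 2 ≤ n) :
    ∀ z ∈ coreWord n, z.natAbs ∈ Finset.Icc 1 n := by
  intro z hz
  simp only [coreWord, List.mem_append, List.mem_cons, mem_ascWord, mem_descWord] at hz
  rw [Finset.mem_Icc]
  omega

theorem le_glueCount_coreWord {n : ℕ} (hn : 2 ≤ n) :
    2 * n ≤ glueCount n (coreWord n) + 6 := by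
  have h1 := le_glueCount_ascWord (n := n) (a := 1) (m := n - 2) (by omega)
  have h2 := le_glueCount_descWord (n := n) (a := 1) (m := n - 2) (by omega)
  rw [coreWord, glueCount_append_cons_of_le (by simp)]
  omega

theorem one_cons_ascWord {n : ℕ} (hn : 2 ≤ n) : 1 :: ascWord 1 (n - 2) = ascWord 0 (n - 1) := by
  rw [show n - 1 = n - 2 + 1 by omega]
  rfl

theorem le_glueCount_one_cons_coreWord {n : ℕ} (hn : 2 ≤ n) :
    2 * n ≤ glueCount n (1 :: coreWord n) + 5 := by
  have h1 := le_glueCount_ascWord (n := n) (a := 0) (m := n - 1) (by omega)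
  have h2 := le_glueCount_descWord (n := n) (a := 1) (m := n - 2) (by omega)
  rw [coreWord, ← List.cons_append, one_cons_ascWord hn, glueCount_append_cons_of_le (by simp)]
  omega

theorem countP_coreWord {n : ℕ} (hn : 2 ≤ n) :
    (coreWord n).countP (fun z => decide (n ≤ z.natAbs)) = 1 := by
  have h1 : (ascWord 1 (n - 2)).countP (fun z => decide (n ≤ z.natAbs)) = 0 := by
    rw [List.countP_eq_zero]
    intro z hz
    rw [mem_ascWord] at hz
    simp only [decide_eq_true_eq]
    omega
  have h2 : (descWord 1 (n - 2)).countP (fun z => decide (n ≤ z.natAbs)) = 0 := by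
    rw [List.countP_eq_zero]
    intro z hz
    rw [mem_descWord] at hz
    simp only [decide_eq_true_eq]
    omega
  rw [coreWord, List.countP_append, List.countP_cons, h1, h2]
  simp

theorem length_quadWord {n : ℕ} (hn : 2 ≤ n) : (quadWord n).length = 8 * n := by
  simp only [quadWord, List.length_append, List.length_cons, List.length_nil, length_coreWord hn]
  omega

theorem countP_quadWord {n : ℕ} (hn : 8 ≤ n) :
    (quadWord n).countP (fun z => decide (n ≤ z.natAbs)) = 8 := by
  have h : ∀ m : ℕ, m < 8 → ¬ n ≤ m := by omega
  simp [quadWord, List.countP_append, countP_coreWord (show 2 ≤ n by omega), h]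

theorem le_glueCount_quadWord {n : ℕ} (hn : 2 ≤ n) :
    8 * n ≤ glueCount n (quadWord n) + 23 := by
  have h1 := le_glueCount_coreWord hn
  have h2 := le_glueCount_one_cons_coreWord hn
  have h3 := glueCount_add_le n
  have e1 := h3 (coreWord n) [3, (n : ℤ), 5]
  have e2 := h3 (coreWord n) [3, (n : ℤ)]
  have e3 := h3 (coreWord n) [3, (n : ℤ), 7]
  have e4 := h3 (coreWord n ++ [3, (n : ℤ), 5]) (coreWord n ++ [3, (n : ℤ)])
  have e5 := h3 (coreWord n ++ [3, (n : ℤ), 5] ++ (coreWord n ++ [3, (n : ℤ)])) (1 :: coreWord n)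
  have e6 := h3 (coreWord n ++ [3, (n : ℤ), 5] ++ (coreWord n ++ [3, (n : ℤ)]) ++
    (1 :: coreWord n)) [3, (n : ℤ), 5]
  have e7 := h3 (coreWord n ++ [3, (n : ℤ), 5] ++ (coreWord n ++ [3, (n : ℤ)]) ++
    (1 :: coreWord n) ++ [3, (n : ℤ), 5]) (coreWord n ++ [3, (n : ℤ), 7])
  rw [quadWord]
  omega

theorem natAbs_of_mem_quadWord {n : ℕ} (hn : 8 ≤ n) :
    ∀ z ∈ quadWord n, z.natAbs ∈ Finset.Icc 1 n := by
  have hA := natAbs_of_mem_coreWord (show 2 ≤ n by omega)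
  intro z hz
  simp only [quadWord, List.mem_append, List.mem_cons, List.not_mem_nil, or_false] at hz
  by_cases hz' : z ∈ coreWord n
  · exact hA z hz'
  · rw [Finset.mem_Icc]
    simp only [hz', or_false, false_or] at hz
    omega

theorem exists_mem_quadWord {n c : ℕ} (hc : c ∈ Finset.Ico 1 n) :
    ∃ z ∈ quadWord n, z.natAbs = c := by
  rw [Finset.mem_Ico] at hc
  refine ⟨c, ?_, by simp⟩
  rcases hc.1.eq_or_lt with rfl | h
  · simp [quadWord]
  · have : (c : ℤ) ∈ coreWord n := by
      simp only [coreWord, List.mem_append, mem_ascWord]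
      omega
    simp [quadWord, this]

theorem isCycleWord_quadWord {n : ℕ} (hn : 8 ≤ n) {U : Finset ℕ} (hU : U ⊆ Finset.Ico 1 n)
    (h1 : 1 ∉ U) (h3 : 3 ∈ U) (h5 : 5 ∈ U) (h7 : 7 ∈ U) :
    IsCycleWord n (((U.erase 3).erase 5).erase 7) (quadWord n ++ quadWord n) := by
  have hA := natAbs_of_mem_coreWord (show 2 ≤ n by omega)
  have hlet : ∀ m : ℕ, m < 8 → (m ≤ n ∧ m < n) := by omega
  have hw : weight n 1 = weight n 3 ∧ weight n 1 = weight n 5 ∧ weight n 1 = weight n 7 := by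
    simp [weight, hlet]
  have s0 := isCycleWord_ascWord_descWord (show 0 < n by omega) hU
  have s1 : IsCycleWord n U ((1 :: coreWord n ++ [-1]) ++ [(n : ℤ)]) := by
    rw [← one_cons_ascWord (by omega), show n - 1 = n - 2 + 1 by omega, descWord_succ] at s0
    simpa [coreWord] using s0
  have s2 := s1.rotate (by
    intro a ha
    by_cases h : a ∈ coreWord n
    · exact hA a h
    · simp [h] at ha; rw [Finset.mem_Icc]; omega)
  have s3 : IsCycleWord n U (((n : ℤ) :: 1 :: coreWord n) ++ [-1]) := by simpa using s2
  have s4 := s3.double (d := 3) h3 h1 hw.1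
  have s5 : IsCycleWord n (U.erase 3) ([(n : ℤ), 1] ++ (coreWord n ++ [3, (n : ℤ), 1] ++
    coreWord n ++ [3])) := by simpa using s4
  have s6 := s5.rotate (by
    intro a ha
    by_cases h : a ∈ coreWord n
    · exact hA a h
    · simp [h] at ha; rw [Finset.mem_Icc]; omega)
  have s7 : IsCycleWord n (U.erase 3) ((coreWord n ++ [3, (n : ℤ), 1] ++
    coreWord n ++ [3, (n : ℤ)]) ++ [1]) := by simpa using s6
  have s8 := s7.double (d := 5) (by simpa using h5) (by simpa using h1) hw.2.1
  have s9 : IsCycleWord n ((U.erase 3).erase 5) ((coreWord n ++ [3, (n : ℤ), 1]) ++ (coreWord n ++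
    [3, (n : ℤ), 5] ++ coreWord n ++ [3, (n : ℤ), 1] ++ coreWord n ++ [3, (n : ℤ), 5])) := by
    simpa using s8
  have s10 := s9.rotate (by
    intro a ha
    by_cases h : a ∈ coreWord n
    · exact hA a h
    · simp [h] at ha; rw [Finset.mem_Icc]; omega)
  have s11 : IsCycleWord n ((U.erase 3).erase 5) ((coreWord n ++ [3, (n : ℤ), 5] ++ coreWord n ++
    [3, (n : ℤ), 1] ++ coreWord n ++ [3, (n : ℤ), 5] ++ coreWord n ++ [3, (n : ℤ)]) ++ [1]) := by
    simpa using s10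
  have s12 := s11.double (d := 7) (by simpa using h7) (by simpa using h1) hw.2.2
  simpa [quadWord] using s12

/-- A cycle word all of whose letters are directions, in which every direction below `n`
occurs at least twice. -/
def IsRichCycleWord (n : ℕ) (U : Finset ℕ) (l : List ℤ) : Prop :=
  IsCycleWord n U l ∧ (∀ z ∈ l, z.natAbs ∈ Finset.Icc 1 n) ∧
    ∀ c ∈ Finset.Ico 1 n, 2 ≤ l.countP (fun z => decide (z.natAbs = c))

theorem IsRichCycleWord.exists_double {n : ℕ} {U : Finset ℕ} {l : List ℤ} {e d : ℕ}
    (h : IsRichCycleWord n U l) (he : e ∈ Finset.Ico 1 n) (hd : d ∈ Finset.Ico 1 n)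
    (hdU : d ∈ U) (heU : e ∉ U) (hw : weight n e = weight n d) :
    ∃ m, IsRichCycleWord n (U.erase d) m ∧ m.length = 2 * l.length ∧
      m.countP (fun z => decide (n ≤ z.natAbs)) =
        2 * l.countP (fun z => decide (n ≤ z.natAbs)) ∧
      2 * glueCount n l ≤ glueCount n m + 4 := by
  obtain ⟨hc, hl, hcount⟩ := h
  obtain ⟨z, hz, hze⟩ : ∃ z ∈ l, z.natAbs = e := by
    simpa using List.countP_pos_iff.1 (zero_lt_two.trans_le (hcount e he))
  obtain ⟨p, q, rfl⟩ := List.append_of_mem hz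
  rw [Finset.mem_Ico] at he hd
  have hrot : IsCycleWord n U ((q ++ p) ++ [z]) := by
    have h1 : IsCycleWord n U ((p ++ [z]) ++ q) := by simpa using hc
    simpa using h1.rotate (by simpa using hl)
  have hdouble := hrot.double (d := (d : ℤ)) (by simpa using hdU) (by rwa [hze])
    (by simpa [hze] using hw)
  rw [Int.natAbs_natCast] at hdouble
  refine ⟨_, ⟨hdouble, ?_, ?_⟩, ?_, ?_, ?_⟩
  · intro a ha
    by_cases had : a = d
    · rw [had, Int.natAbs_natCast, Finset.mem_Icc]
      omega
    · refine hl a ?_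
      simp only [List.mem_append, List.mem_cons, List.not_mem_nil, or_false, had] at ha ⊢
      tauto
  · intro c hcn
    have := hcount c hcn
    simp only [List.countP_append, List.countP_cons, List.countP_nil] at this ⊢
    split_ifs at this ⊢ <;> omega
  · simp only [List.length_append, List.length_cons, List.length_nil]
    omega
  · have h1 : ¬ n ≤ z.natAbs := by omega
    have h2 : ¬ n ≤ (d : ℤ).natAbs := by omega
    simp only [List.countP_append, List.countP_cons, List.countP_nil, h1, h2]
    simp
    omega
  · have h1 := glueCount_append_cons_le n p q z
    have h2 := glueCount_add_le n q p
    have h3 := glueCount_add_le n (q ++ p) [(d : ℤ)]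
    have h4 := glueCount_add_le n ((q ++ p) ++ [(d : ℤ)]) ((q ++ p) ++ [(d : ℤ)])
    omega

/-- Iterated doubling until no free coordinate is left. -/
theorem IsRichCycleWord.exists_of_forall {n : ℕ} {V U : Finset ℕ} {l : List ℤ} {t : ℕ}
    (hVU : ∀ d ∈ V, d ∈ Finset.Ico 1 n ∧
      ∃ e ∈ Finset.Ico 1 n, e ∉ V ∧ e ∉ U ∧ weight n e = weight n d)
    (hUV : U ⊆ V) (h : IsRichCycleWord n U l) (ht : t + 4 ≤ glueCount n l) :
    ∃ m, IsRichCycleWord n ∅ m ∧ m.length = 2 ^ U.card * l.length ∧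
      m.countP (fun z => decide (n ≤ z.natAbs)) =
        2 ^ U.card * l.countP (fun z => decide (n ≤ z.natAbs)) ∧
      2 ^ U.card * t + 4 ≤ glueCount n m := by
  induction hr : U.card generalizing U l t with
  | zero =>
    rw [Finset.card_eq_zero] at hr
    subst hr
    exact ⟨l, h, by simp, by simp, by simpa using ht⟩
  | succ r ih =>
    obtain ⟨d, hdU⟩ : U.Nonempty := Finset.card_pos.1 (by omega)
    obtain ⟨hd, e, he, heV, heU, hw⟩ := hVU d (hUV hdU)
    obtain ⟨m, hm, h1, h2, h3⟩ := h.exists_double he hd hdU heU hw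
    obtain ⟨m', hm', h1', h2', h3'⟩ := ih (U := U.erase d) (l := m) (t := 2 * t)
      (fun c hc => by
        obtain ⟨hc, e, he, heV, heU, hw⟩ := hVU c hc
        exact ⟨hc, e, he, heV, fun h => heU (Finset.mem_of_mem_erase h), hw⟩)
      ((Finset.erase_subset _ _).trans hUV) hm (by omega)
      (by rw [Finset.card_erase_of_mem hdU, hr]; rfl)
    refine ⟨m', hm', ?_, ?_, ?_⟩
    · rw [h1', h1, pow_succ, mul_assoc]
    · rw [h2', h2, pow_succ, mul_assoc]
    · rw [pow_succ, mul_assoc]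
      exact h3'

/-- The coordinates that are not powers of two. -/
def freeCoords (k : ℕ) : Finset ℕ := Finset.Ico 1 (2 ^ k) \ (Finset.range k).image (2 ^ ·)

theorem card_freeCoords (k : ℕ) : (freeCoords k).card + k + 1 = 2 ^ k := by
  have hsub : (Finset.range k).image (2 ^ ·) ⊆ Finset.Ico 1 (2 ^ k) := by
    intro a ha
    simp only [Finset.mem_image, Finset.mem_range] at ha
    obtain ⟨j, hj, rfl⟩ := ha
    exact Finset.mem_Ico.2 ⟨Nat.one_le_two_pow, Nat.pow_lt_pow_right one_lt_two hj⟩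
  have hcard : ((Finset.range k).image (2 ^ ·)).card = k := by
    rw [Finset.card_image_of_injective _ (Nat.pow_right_injective le_rfl), Finset.card_range]
  have h := Finset.card_sdiff_add_card_eq_card hsub
  rw [hcard, Nat.card_Ico] at h
  have := Nat.one_le_two_pow (n := k)
  rw [freeCoords]
  omega

theorem two_pow_notMem_freeCoords {k j : ℕ} : 2 ^ j ∉ freeCoords k := by
  simp only [freeCoords, Finset.mem_sdiff, Finset.mem_Ico, Finset.mem_image, Finset.mem_range]
  rintro ⟨⟨-, h⟩, hj⟩
  exact hj ⟨j, (Nat.pow_lt_pow_iff_right one_lt_two).1 h, rfl⟩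

theorem odd_mem_freeCoords {k d : ℕ} (hd : Odd d) (h1 : 1 < d) (hk : d < 2 ^ k) :
    d ∈ freeCoords k := by
  simp only [freeCoords, Finset.mem_sdiff, Finset.mem_Ico, Finset.mem_image, Finset.mem_range]
  refine ⟨⟨h1.le, hk⟩, ?_⟩
  rintro ⟨j, -, rfl⟩
  cases j with
  | zero => simp at h1
  | succ j => exact absurd hd (by simp [pow_succ])

theorem exists_weight_eq_of_mem_freeCoords {k d : ℕ} (hd : d ∈ freeCoords k) :
    d ∈ Finset.Ico 1 (2 ^ k) ∧
      ∃ e ∈ Finset.Ico 1 (2 ^ k), e ∉ freeCoords k ∧ weight (2 ^ k) e = weight (2 ^ k) d := by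
  have hd' := (Finset.mem_sdiff.1 hd).1
  obtain ⟨h1, h2⟩ := Finset.mem_Ico.1 hd'
  obtain ⟨j, hj, h⟩ := exists_two_pow_xor_pred_eq h1
  refine ⟨hd', 2 ^ j, Finset.mem_Ico.2 ⟨Nat.one_le_two_pow, hj.trans_lt h2⟩,
    two_pow_notMem_freeCoords, ?_⟩
  rw [weight, weight, if_pos (hj.trans_lt h2), if_pos h2, h]

theorem exists_richCycleWord {k : ℕ} (hk : 3 ≤ k) :
    ∃ r m, 2 ^ 2 ^ k = 2 ^ r * (16 * 2 ^ k) ∧ IsRichCycleWord (2 ^ k) ∅ m ∧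
      m.length = 2 ^ 2 ^ k ∧ m.countP (fun z => decide (2 ^ k ≤ z.natAbs)) = 2 ^ r * 16 ∧
      2 ^ r * (16 * 2 ^ k - 50) + 4 ≤ glueCount (2 ^ k) m := by
  have hn : 8 ≤ 2 ^ k := Nat.pow_le_pow_right (n := 2) two_pos hk
  have h1 : 1 ∉ freeCoords k := two_pow_notMem_freeCoords (j := 0)
  have h3 : 3 ∈ freeCoords k := odd_mem_freeCoords (by decide) (by omega) (by omega)
  have h5 : 5 ∈ freeCoords k := odd_mem_freeCoords (by decide) (by omega) (by omega)
  have h7 : 7 ∈ freeCoords k := odd_mem_freeCoords (by decide) (by omega) (by omega)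
  have hcyc := isCycleWord_quadWord hn (fun d hd => (Finset.mem_sdiff.1 hd).1) h1 h3 h5 h7
  set U := (((freeCoords k).erase 3).erase 5).erase 7 with hU
  have hUsub : U ⊆ freeCoords k := fun d hd => by
    simp only [hU, Finset.mem_erase] at hd
    exact hd.2.2.2
  have hcard : 2 ^ k = U.card + 4 + k := by
    have := card_freeCoords k
    rw [hU, Finset.card_erase_of_mem (by simp [h7]), Finset.card_erase_of_mem (by simp [h5]),
      Finset.card_erase_of_mem h3]
    have h4 : 3 ≤ (freeCoords k).card := by
      have : ({3, 5, 7} : Finset ℕ) ⊆ freeCoords k := by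
        simp [Finset.insert_subset_iff, h3, h5, h7]
      simpa using Finset.card_le_card this
    omega
  have hrich : IsRichCycleWord (2 ^ k) U (quadWord (2 ^ k) ++ quadWord (2 ^ k)) := by
    refine ⟨hcyc, ?_, ?_⟩
    · intro z hz
      exact natAbs_of_mem_quadWord hn z (by simpa using hz)
    · intro c hc
      obtain ⟨z, hz, hzc⟩ := exists_mem_quadWord hc
      have : 0 < (quadWord (2 ^ k)).countP (fun z => decide (z.natAbs = c)) :=
        List.countP_pos_iff.2 ⟨z, hz, by simpa using hzc⟩
      rw [List.countP_append]
      omega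
  have hglue := glueCount_add_le (2 ^ k) (quadWord (2 ^ k)) (quadWord (2 ^ k))
  have hglue' := le_glueCount_quadWord (n := 2 ^ k) (by omega)
  obtain ⟨m, hm, hlen, hcount, hg⟩ := hrich.exists_of_forall (V := freeCoords k)
    (t := 16 * 2 ^ k - 50) (fun d hd => by
      obtain ⟨hd, e, he, heV, hw⟩ := exists_weight_eq_of_mem_freeCoords hd
      exact ⟨hd, e, he, heV, fun h => heV (hUsub h), hw⟩) hUsub (by omega)
  have hpow : 2 ^ 2 ^ k = 2 ^ U.card * (16 * 2 ^ k) := by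
    conv_lhs => rw [hcard]
    rw [pow_add, pow_add]
    ring
  refine ⟨U.card, m, hpow, hm, ?_, ?_, hg⟩
  · rw [hlen, List.length_append, length_quadWord (by omega), hpow]
    ring
  · rw [hcount, List.countP_append, countP_quadWord hn]

theorem exists_isHamPath_of_isRichCycleWord {n t c : ℕ} {m : List ℤ} (hn : 0 < n)
    (hm : IsRichCycleWord n ∅ m) (hlen : m.length = 2 ^ n)
    (hcount : m.countP (fun z => decide (n ≤ z.natAbs)) = c) (hc : 0 < c)
    (ht : t ≤ glueCount n m) :
    ∃ (l : List (Finset ℕ)) (bs : List (List ℕ)),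
      IsHamPath n l ∧ IsRunPartition (n - 1) (flipSeq l) bs ∧
      runLambda (n - 1) bs = t ∧ runNu (n - 1) bs + t + c = 2 ^ n := by
  obtain ⟨hcyc, hlet, -⟩ := hm
  obtain ⟨z, hz, hzn⟩ : ∃ z ∈ m, n ≤ z.natAbs := by
    have hpos := hc
    rw [← hcount, List.countP_pos_iff] at hpos
    simpa only [decide_eq_true_eq] using hpos
  obtain ⟨p, q, rfl⟩ := List.append_of_mem hz
  have hrot : IsCycleWord n ∅ ((q ++ p) ++ [z]) := by
    have h1 : IsCycleWord n ∅ ((p ++ [z]) ++ q) := by simpa using hcyc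
    simpa using h1.rotate (by simpa using hlet)
  have hperm : ((q ++ p) ++ [z]).Perm (p ++ z :: q) := by
    rw [List.append_assoc]
    exact List.perm_append_comm.trans (by simp)
  obtain ⟨x, hx, -, hnd, -⟩ := hrot
  have hg : t ≤ glueCount n (q ++ p) := by
    have := glueCount_add_le n q p
    rw [glueCount_append_cons_of_le hzn] at ht
    omega
  obtain ⟨bs, hbs, hlam, hnu⟩ := exists_runPartition hn (l := q ++ p) (fun a ha h0 => by
    have := hlet a (hperm.mem_iff.1 (List.mem_append_left _ ha))
    simp [h0] at this) hg
  refine ⟨walk x ((q ++ p) ++ [z]), bs, isHamPath_walk hx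
    (fun a ha => hlet a (hperm.mem_iff.1 ha)) hnd (hperm.length_eq.trans hlen), ?_, hlam, ?_⟩
  · rwa [flipSeq_walk]
  · have h1 := hperm.countP_eq (fun z => decide (n ≤ z.natAbs))
    have h2 := hperm.length_eq
    rw [hlen, List.length_append] at h2
    rw [hcount, List.countP_append] at h1
    simp only [List.countP_cons, List.countP_nil, List.length_cons, List.length_nil, hzn,
      decide_true, if_true] at h1 h2
    omega

end Construction

/-- Lemma 3.1: for `k ≥ 2` and `n = 2^k` there is a Hamiltonian path `P` in `Q_n` with an
`(n−1)`-run partition of its flip sequence with `ν = 6`, `λ = 8` if `k = 2`, and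
`ν = (17/8)·(2^n/n) − 4`, `λ = 2^n − (25/8)·(2^n/n) + 4` if `k ≥ 3`
(the `k ≥ 3` equations are stated multiplied through by `8n`). -/
theorem stmt_11 (k : ℕ) (hk : 2 ≤ k) (n : ℕ) (hn : n = 2 ^ k) :
    ∃ (l : List (Finset ℕ)) (bs : List (List ℕ)),
      IsHamPath n l ∧ IsRunPartition (n - 1) (flipSeq l) bs ∧
      (k = 2 → runNu (n - 1) bs = 6 ∧ runLambda (n - 1) bs = 8) ∧
      (3 ≤ k →
        8 * n * runNu (n - 1) bs + 32 * n = 17 * 2 ^ n ∧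
        8 * n * runLambda (n - 1) bs + 25 * 2 ^ n = 8 * n * 2 ^ n + 32 * n) := by
  subst hn
  rcases hk.eq_or_lt with rfl | hk
  · have hflip := flipSeq_walk ∅ [1, 2, 3, 2, 1, 2, 3, 4, 1, 2, 3, 2, 1, 2, 3] 1
    refine ⟨walk ∅ ([1, 2, 3, 2, 1, 2, 3, 4, 1, 2, 3, 2, 1, 2, 3] ++ [1]),
      [[1, 2, 3], [2, 1], [2, 3], [4], [1, 2, 3], [2, 1], [2, 3]],
      isHamPath_walk (by simp) (by decide) (by decide) rfl, ?_, fun _ => by decide, by omega⟩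
    rw [hflip]
    refine ⟨rfl, ?_⟩
    simp [IsRunBlock, List.Chain']
  · obtain ⟨r, m, hpow, hm, hlen, hcount, hglue⟩ := exists_richCycleWord (show 3 ≤ k from hk)
    obtain ⟨l, bs, hl, hbs, hlam, hnu⟩ := exists_isHamPath_of_isRichCycleWord
      (by positivity) hm hlen hcount (by positivity) hglue
    refine ⟨l, bs, hl, hbs, by omega, fun _ => ?_⟩
    have hn : 8 ≤ 2 ^ k := Nat.pow_le_pow_right (n := 2) two_pos hk
    obtain ⟨s, hs⟩ : ∃ s, 16 * 2 ^ k = s + 50 := ⟨16 * 2 ^ k - 50, by omega⟩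
    rw [hlam]
    rw [hpow] at hnu ⊢
    rw [hs, Nat.add_sub_cancel] at hnu ⊢
    have hnu' : runNu (2 ^ k - 1) bs + 4 = 34 * 2 ^ r := by linarith
    constructor
    · calc 8 * 2 ^ k * runNu (2 ^ k - 1) bs + 32 * 2 ^ k
          = 8 * 2 ^ k * (runNu (2 ^ k - 1) bs + 4) := by ring
        _ = 17 * (2 ^ r * (16 * 2 ^ k)) := by rw [hnu']; ring
        _ = 17 * (2 ^ r * (s + 50)) := by rw [hs]
    · calc 8 * 2 ^ k * (2 ^ r * s + 4) + 25 * (2 ^ r * (s + 50))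
          = 8 * 2 ^ k * (2 ^ r * s + 4) + 25 * (2 ^ r * (16 * 2 ^ k)) := by rw [hs]
        _ = 8 * 2 ^ k * (2 ^ r * (s + 50)) + 32 * 2 ^ k := by ring
end

section
/- For every k ≥ 2, n = 2^k and 0 ≤ m < n, there exists a Hamiltonian path P in the hypercube Q_{n+m} together with an (n−1)-run partition of its flip sequence whose parameters satisfy: ν = 6·2^m and λ = 8·2^m if k = 2, and ν = ((17/8)·(2^n/n) − 4)·2^m and λ = (2^n − (25/8)·(2^n/n) + 4)·2^m if k ≥ 3. -/
open scoped symmDiff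

theorem runBlocks_append (ρ : ℕ) (as bs : List (List ℕ)) :
    runBlocks ρ (as ++ bs) = runBlocks ρ as ++ runBlocks ρ bs :=
  List.filter_append ..

theorem runNu_append (ρ : ℕ) (as bs : List (List ℕ)) :
    runNu ρ (as ++ bs) = runNu ρ as + runNu ρ bs := by
  simp [runNu, runBlocks_append]

theorem runLambda_append (ρ : ℕ) (as bs : List (List ℕ)) :
    runLambda ρ (as ++ bs) = runLambda ρ as + runLambda ρ bs := by
  simp [runLambda, runBlocks_append]

theorem runNu_singleton_of_le {ρ : ℕ} {b : List ℕ} (hb : ∀ a ∈ b, a ≤ ρ) :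
    runNu ρ [b] = 1 := by
  have : runBlocks ρ [b] = [b] := by simpa [runBlocks] using hb
  simp [runNu, this]

theorem runLambda_singleton_of_le {ρ : ℕ} {b : List ℕ} (hb : ∀ a ∈ b, a ≤ ρ) :
    runLambda ρ [b] = b.length - 1 := by
  have : runBlocks ρ [b] = [b] := by simpa [runBlocks] using hb
  simp [runLambda, this]

theorem runNu_singleton_of_lt {ρ a : ℕ} (h : ρ < a) : runNu ρ [[a]] = 0 := by
  simp [runNu, runBlocks, h]

theorem runLambda_singleton_of_lt {ρ a : ℕ} (h : ρ < a) : runLambda ρ [[a]] = 0 := by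
  simp [runLambda, runBlocks, h]

theorem IsRunBlock.singleton {ρ a : ℕ} (h : a ≤ ρ) : IsRunBlock ρ [a] :=
  ⟨by simp, by simpa using h, Or.inl (List.isChain_singleton a)⟩

theorem IsRunPartition.append {ρ : ℕ} {σ τ : List ℕ} {as bs : List (List ℕ)}
    (ha : IsRunPartition ρ σ as) (hb : IsRunPartition ρ τ bs) :
    IsRunPartition ρ (σ ++ τ) (as ++ bs) := by
  refine ⟨by rw [List.flatten_append, ha.1, hb.1], fun b hm => ?_⟩
  rcases List.mem_append.1 hm with h | h
  · exact ha.2 b h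
  · exact hb.2 b h

/-- If some run of a partition has length at least two, splitting off its first entry trades one
unit of `λ` for one unit of `ν`. -/
theorem IsRunPartition.exists_split {ρ : ℕ} {σ : List ℕ} {bs : List (List ℕ)}
    (h : IsRunPartition ρ σ bs) (hl : 0 < runLambda ρ bs) :
    ∃ bs', IsRunPartition ρ σ bs' ∧ runNu ρ bs' = runNu ρ bs + 1 ∧
      runLambda ρ bs' + 1 = runLambda ρ bs := by
  obtain ⟨b, hb, hlen⟩ : ∃ b ∈ runBlocks ρ bs, 2 ≤ b.length := by
    by_contra! hcon
    refine hl.ne' (List.sum_eq_zero fun x hx => ?_)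
    obtain ⟨b, hb, rfl⟩ := List.mem_map.1 hx
    have := hcon b hb
    omega
  obtain ⟨hb, hle⟩ := List.mem_filter.1 hb
  replace hle : ∀ a ∈ b, a ≤ ρ := by simpa using hle
  obtain ⟨x, y, r, rfl⟩ : ∃ x y r, b = x :: y :: r := by
    match b, hlen with
    | x :: y :: r, _ => exact ⟨x, y, r, rfl⟩
  obtain ⟨as, cs, rfl⟩ := List.append_of_mem hb
  have hx : x ≤ ρ := hle x (by simp)
  have hr : ∀ a ∈ y :: r, a ≤ ρ := fun a ha => hle a (List.mem_cons_of_mem _ ha)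
  have hsplit : ∀ zs, (as ++ zs :: cs) = as ++ ([zs] ++ cs) := fun zs => by simp
  refine ⟨as ++ ([[x]] ++ ([y :: r] ++ cs)), ⟨by rw [← h.1]; simp, fun c hc => ?_⟩, ?_, ?_⟩
  · simp only [List.mem_append, List.mem_singleton] at hc
    rcases hc with hc | rfl | rfl | hc
    · exact h.2 c (by simp [hc])
    · exact Or.inl (.singleton hx)
    · left
      rcases h.2 _ hb with h' | ⟨a, _, h'⟩
      · exact ⟨by simp, hr, h'.2.2.imp List.IsChain.of_cons List.IsChain.of_cons⟩
      · simp at h'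
    · exact h.2 c (by simp [hc])
  · rw [hsplit]
    simp only [runNu_append, runNu_singleton_of_le hr, runNu_singleton_of_le hle,
      runNu_singleton_of_le (b := [x]) (by simpa using hx)]
    omega
  · rw [hsplit]
    simp only [runLambda_append, runLambda_singleton_of_le hr, runLambda_singleton_of_le hle,
      runLambda_singleton_of_le (b := [x]) (by simpa using hx), List.length_cons, List.length_nil]
    omega

theorem IsRunPartition.exists_refine {ρ : ℕ} {σ : List ℕ} (d : ℕ) :
    ∀ {bs : List (List ℕ)}, IsRunPartition ρ σ bs → d ≤ runLambda ρ bs →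
    ∃ bs', IsRunPartition ρ σ bs' ∧ runNu ρ bs' = runNu ρ bs + d ∧
      runLambda ρ bs' + d = runLambda ρ bs := by
  induction d with
  | zero => exact fun {bs} h _ => ⟨bs, h, rfl, rfl⟩
  | succ d ih =>
    intro bs h hd
    obtain ⟨bs₁, h₁, hν, hl⟩ := h.exists_split (by omega)
    obtain ⟨bs₂, h₂, hν₂, hl₂⟩ := ih h₁ (by omega)
    exact ⟨bs₂, h₂, by omega, by omega⟩

theorem flipSeq_append_cons (l : List (Finset ℕ)) (s t : Finset ℕ) (r : List (Finset ℕ)) :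
    flipSeq ((l ++ [s]) ++ t :: r) = flipSeq (l ++ [s]) ++ (s ∆ t).sum id :: flipSeq (t :: r) := by
  induction l with
  | nil => simp [flipSeq]
  | cons a l ih =>
    cases l with
    | nil => simp [flipSeq]
    | cons b l => simpa [flipSeq] using ih

theorem symmDiff_symmDiff_symmDiff_right (s t z : Finset ℕ) : (s ∆ z) ∆ (t ∆ z) = s ∆ t := by
  rw [symmDiff_symmDiff_symmDiff_comm, symmDiff_self, symmDiff_bot]

theorem flipSeq_map_symmDiff (l : List (Finset ℕ)) (z : Finset ℕ) :
    flipSeq (l.map (· ∆ z)) = flipSeq l := by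
  simp only [flipSeq, ← List.map_tail, List.zip_map, List.map_map]
  refine List.map_congr_left fun p _ => ?_
  simp [symmDiff_symmDiff_symmDiff_right]

/-- Two translated copies of a Hamiltonian path, joined by an edge in a new direction. -/
theorem IsHamPath.exists_double {N ρ : ℕ} {l : List (Finset ℕ)} {bs : List (List ℕ)}
    (hl : IsHamPath N l) (hbs : IsRunPartition ρ (flipSeq l) bs) (hρ : ρ ≤ N) :
    ∃ l' bs', IsHamPath (N + 1) l' ∧ IsRunPartition ρ (flipSeq l') bs' ∧
      runNu ρ bs' = 2 * runNu ρ bs ∧ runLambda ρ bs' = 2 * runLambda ρ bs := by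
  obtain ⟨hsub, hnd, hlen, hch⟩ := hl
  have hne : l ≠ [] := by
    rintro rfl
    exact (Nat.two_pow_pos N).ne hlen
  obtain ⟨i, b, hib⟩ : ∃ i b, l = i ++ [b] := ⟨_, _, (List.dropLast_append_getLast hne).symm⟩
  obtain ⟨a, r, har⟩ := List.exists_cons_of_ne_nil hne
  have hnot : ∀ s ∈ l, N + 1 ∉ s := fun s hs h => by
    have := Finset.mem_Icc.1 (hsub s hs h)
    omega
  have hIcc : ∀ s ∈ l, s ⊆ Finset.Icc 1 (N + 1) := fun s hs =>
    (hsub s hs).trans (Finset.Icc_subset_Icc_right (by omega))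
  have ha : a ∈ l := by simp [har]
  have hb : b ∈ l := by simp [hib]
  set z : Finset ℕ := (a ∆ b) ∆ {N + 1} with hz
  have haz : b ∆ (a ∆ z) = {N + 1} := by
    rw [hz, ← symmDiff_assoc a, symmDiff_symmDiff_cancel_left, symmDiff_symmDiff_cancel_left]
  have hmemz : N + 1 ∈ z := by
    simp [hz, Finset.mem_symmDiff, hnot a ha, hnot b hb]
  have hzIcc : z ⊆ Finset.Icc 1 (N + 1) := by
    intro x hx
    simp only [hz, Finset.mem_symmDiff, Finset.mem_singleton] at hx
    by_cases hxa : x ∈ a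
    · exact hIcc a ha hxa
    by_cases hxb : x ∈ b
    · exact hIcc b hb hxb
    simp [hxa, hxb] at hx
    simp [hx]
  have hflip : flipSeq (l ++ l.map (· ∆ z)) = flipSeq l ++ ([N + 1] ++ flipSeq l) := by
    have h1 : l.map (· ∆ z) = a ∆ z :: r.map (· ∆ z) := by rw [har, List.map_cons]
    conv_lhs => rw [h1, hib]
    rw [flipSeq_append_cons, haz, ← hib, ← h1, flipSeq_map_symmDiff]
    simp
  refine ⟨l ++ l.map (· ∆ z), bs ++ ([[N + 1]] ++ bs), ⟨?_, ?_, ?_, ?_⟩, ?_, ?_, ?_⟩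
  · intro s hs
    rcases List.mem_append.1 hs with hs | hs
    · exact hIcc s hs
    · obtain ⟨t, ht, rfl⟩ := List.mem_map.1 hs
      exact (symmDiff_le_sup : t ∆ z ≤ t ⊔ z).trans (sup_le (hIcc t ht) hzIcc)
  · refine hnd.append (hnd.map (symmDiff_left_injective z)) fun s hs hs' => ?_
    obtain ⟨t, ht, rfl⟩ := List.mem_map.1 hs'
    exact hnot _ hs (Finset.mem_symmDiff.2 (Or.inr ⟨hmemz, hnot t ht⟩))
  · simp [hlen, pow_succ, mul_two]
  · refine List.isChain_append.2 ⟨hch, ?_, ?_⟩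
    · rw [List.isChain_map]
      exact hch.imp fun s t ⟨d, hd⟩ => ⟨d, by rw [symmDiff_symmDiff_symmDiff_right, hd]⟩
    · intro x hx y hy
      rw [hib, List.getLast?_append_of_ne_nil _ (by simp)] at hx
      rw [har] at hy
      simp only [List.getLast?_singleton, Option.mem_some_iff, List.map_cons, List.head?_cons] at hx hy
      subst hx hy
      exact ⟨N + 1, haz⟩
  · rw [hflip]
    refine hbs.append (IsRunPartition.append ⟨by simp, fun b hb => Or.inr ⟨N + 1, by omega, ?_⟩⟩ hbs)
    simpa using hb
  · rw [runNu_append, runNu_append, runNu_singleton_of_lt (by omega)]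
    omega
  · rw [runLambda_append, runLambda_append, runLambda_singleton_of_lt (by omega)]
    omega

theorem IsHamPath.exists_double_iterate {N ρ : ℕ} {l : List (Finset ℕ)} {bs : List (List ℕ)}
    (hl : IsHamPath N l) (hbs : IsRunPartition ρ (flipSeq l) bs) (hρ : ρ ≤ N) (m : ℕ) :
    ∃ l' bs', IsHamPath (N + m) l' ∧ IsRunPartition ρ (flipSeq l') bs' ∧
      runNu ρ bs' = runNu ρ bs * 2 ^ m ∧ runLambda ρ bs' = runLambda ρ bs * 2 ^ m := by
  induction m with
  | zero => exact ⟨l, bs, hl, hbs, by simp, by simp⟩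
  | succ m ih =>
    obtain ⟨l₁, bs₁, hl₁, hbs₁, hν, hlam⟩ := ih
    obtain ⟨l₂, bs₂, hl₂, hbs₂, hν₂, hlam₂⟩ := hl₁.exists_double hbs₁ (by omega)
    exact ⟨l₂, bs₂, hl₂, hbs₂, by rw [hν₂, hν]; ring, by rw [hlam₂, hlam]; ring⟩

theorem exists_isHamPath_three : ∃ l bs, IsHamPath 3 l ∧ IsRunPartition 3 (flipSeq l) bs ∧
    runNu 3 bs = 3 ∧ runLambda 3 bs = 4 := by
  refine ⟨[∅, {1}, {1, 2}, {1, 2, 3}, {1, 3}, {3}, {2, 3}, {2}], [[1, 2, 3], [2, 1], [2, 3]],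
    ⟨by decide, by decide, by decide, ?_⟩, ⟨by decide, ?_⟩, by decide, by decide⟩
  · simp only [List.Chain', List.isChain_cons_cons, List.isChain_singleton, and_true]
    exact ⟨⟨1, by decide⟩, ⟨2, by decide⟩, ⟨3, by decide⟩, ⟨2, by decide⟩, ⟨1, by decide⟩,
      ⟨2, by decide⟩, ⟨3, by decide⟩⟩
  · intro b hb
    left
    fin_cases hb <;> simp [IsRunBlock, List.Chain']

/-- The number of the bit flipped at time `j` by the cyclic reflected Gray code on the bits
`0, …, r`. -/
def ruler : ℕ → ℕ → ℕ
  | 0, _ => 0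
  | r + 1, j => if j % 2 = 0 then 0 else ruler r (j / 2) + 1

theorem ruler_le (r j : ℕ) : ruler r j ≤ r := by
  induction r generalizing j with
  | zero => simp [ruler]
  | succ r ih =>
    rw [ruler]
    split_ifs
    · omega
    · have := ih (j / 2)
      omega

theorem count_ruler_zero (r j : ℕ) : Nat.count (fun t => ruler (r + 1) t = 0) j = (j + 1) / 2 := by
  induction j with
  | zero => simp
  | succ j ih =>
    rw [Nat.count_succ, ih, ruler]
    rcases Nat.mod_two_eq_zero_or_one j with h | h <;> simp only [h] <;> simp <;> omega

theorem count_ruler_succ (r u j : ℕ) :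
    Nat.count (fun t => ruler (r + 1) t = u + 1) j = Nat.count (fun t => ruler r t = u) (j / 2) := by
  induction j with
  | zero => simp
  | succ j ih =>
    rw [Nat.count_succ, ih, ruler]
    rcases Nat.mod_two_eq_zero_or_one j with h | h
    · rw [if_neg (by simp [h]), show (j + 1) / 2 = j / 2 by omega, add_zero]
    · rw [show (j + 1) / 2 = j / 2 + 1 by omega, Nat.count_succ]
      simp [h]

/-- The cyclic Gray code with flips `ruler r` visits pairwise distinct vertices within a period. -/
theorem modEq_of_count_ruler {r j j' : ℕ}
    (h : ∀ u ≤ r, Nat.count (fun t => ruler r t = u) j ≡ Nat.count (fun t => ruler r t = u) j' [MOD 2]) :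
    j ≡ j' [MOD 2 ^ (r + 1)] := by
  induction r generalizing j j' with
  | zero => simpa [ruler] using h 0 le_rfl
  | succ r ih =>
    have h1 : j / 2 ≡ j' / 2 [MOD 2 ^ (r + 1)] := ih fun u hu => by
      simpa only [count_ruler_succ] using h (u + 1) (by omega)
    have h0 := h 0 (by omega)
    simp only [count_ruler_zero] at h0
    have h2 : j / 2 ≡ j' / 2 [MOD 2] := h1.of_dvd (dvd_pow_self 2 (by omega))
    unfold Nat.ModEq at *
    rw [pow_succ', Nat.mod_mul, Nat.mod_mul, h1]
    omega

theorem padicValNat_mod_two_pow_succ (k t : ℕ) : padicValNat 2 (t % 2 ^ k + 1) = ruler k t := by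
  induction k generalizing t with
  | zero => simp [ruler, Nat.mod_one]
  | succ k ih =>
    rw [ruler, pow_succ', Nat.mod_mul]
    split_ifs with h
    · exact padicValNat.eq_zero_of_not_dvd (by omega)
    · rw [show t % 2 + 2 * (t / 2 % 2 ^ k) + 1 = 2 * (t / 2 % 2 ^ k + 1) by omega,
        padicValNat.mul (by norm_num) (by omega), padicValNat.self (by norm_num), ih, add_comm]

theorem padicValNat_two_pow_mul_odd (v u : ℕ) : padicValNat 2 (2 ^ v * (2 * u + 1)) = v := by
  rw [padicValNat.mul (by positivity) (by omega), padicValNat.prime_pow,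
    padicValNat.eq_zero_of_not_dvd (by omega), add_zero]

theorem count_mod_eq_and (Q : ℕ → Prop) [DecidablePred Q] {M a : ℕ} (ha : a < M) (t : ℕ) :
    Nat.count (fun τ => τ % M = a ∧ Q (τ / M)) t = Nat.count Q ((t + (M - 1 - a)) / M) := by
  induction t with
  | zero => rw [Nat.count_zero, Nat.div_eq_of_lt (by omega), Nat.count_zero]
  | succ t ih =>
    have hM : 0 < M := by omega
    have hlt := Nat.mod_lt t hM
    have hdiv : ∀ x < 2 * M, x / M = if x < M then 0 else 1 := fun x hx => by
      split_ifs with h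
      · exact Nat.div_eq_of_lt h
      · exact (Nat.div_eq_iff hM).2 ⟨by omega, by omega⟩
    have h1 : (t + (M - 1 - a)) / M = t / M + if t % M ≤ a then 0 else 1 := by
      conv_lhs => rw [← Nat.div_add_mod t M, add_assoc, Nat.mul_add_div hM,
        hdiv (t % M + (M - 1 - a)) (by omega)]
      congr 1
      split_ifs <;> omega
    have h2 : (t + 1 + (M - 1 - a)) / M = t / M + if t % M < a then 0 else 1 := by
      conv_lhs => rw [← Nat.div_add_mod t M, add_assoc, add_assoc, Nat.mul_add_div hM,
        hdiv (t % M + (1 + (M - 1 - a))) (by omega)]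
      congr 1
      split_ifs <;> omega
    rw [Nat.count_succ, ih, h1, h2]
    rcases lt_trichotomy (t % M) a with h | h | h
    · simp [h, h.le, h.ne]
    · simp [h, Nat.count_succ]
    · simp [h.not_ge, h.not_gt, h.ne']

theorem modEq_mul_of_div {a b M R : ℕ} (h : a ≡ b [MOD M]) (h' : a / M ≡ b / M [MOD R]) :
    a ≡ b [MOD M * R] := by
  unfold Nat.ModEq at *
  rw [Nat.mod_mul, Nat.mod_mul, h, h']

theorem div_modEq_of_mul {a b M R : ℕ} (h : a ≡ b [MOD M * R]) : a / M ≡ b / M [MOD R] := by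
  unfold Nat.ModEq at *
  rw [← Nat.mod_mul_right_div_self, h, Nat.mod_mul_right_div_self]

/-- The exponent of `2` in the time between two carries into the bits of class `v`. -/
def carryExp (k v : ℕ) : ℕ := k + 1 + ∑ u ∈ Finset.range v, (2 ^ (k - 1 - u) - 1)

theorem carryExp_zero (k : ℕ) : carryExp k 0 = k + 1 := by simp [carryExp]

theorem carryExp_succ (k v : ℕ) : carryExp k (v + 1) = carryExp k v + (2 ^ (k - 1 - v) - 1) := by
  simp [carryExp, Finset.sum_range_succ, add_assoc]

theorem carryExp_mono (k : ℕ) : Monotone (carryExp k) :=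
  monotone_nat_of_le_succ fun v => by rw [carryExp_succ]; omega

theorem carryExp_add {k v : ℕ} (hv : v < k) :
    carryExp k v + v + 2 ^ (k - v) = 2 ^ k + k + 1 := by
  induction v with
  | zero => simp [carryExp_zero]; omega
  | succ v ih =>
    have := ih (by omega)
    rw [carryExp_succ]
    have h1 : 2 ^ (k - v) = 2 * 2 ^ (k - 1 - v) := by
      rw [← pow_succ']
      congr 1
      omega
    rw [show k - (v + 1) = k - 1 - v by omega]
    have := Nat.one_le_two_pow (n := k - 1 - v)
    omega

theorem carryExp_pred {k : ℕ} (hk : 1 ≤ k) : carryExp k (k - 1) = 2 ^ k := by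
  have := carryExp_add (k := k) (v := k - 1) (by omega)
  rw [show k - (k - 1) = 1 by omega] at this
  omega

/-- The vertex reached at time `t` when starting at `∅` and flipping `δ 0, δ 1, …`. -/
def vertexAt (δ : ℕ → ℕ) (N t : ℕ) : Finset ℕ :=
  {i ∈ Finset.Icc 1 N | Odd (Nat.count (fun τ => δ τ = i) t)}

theorem vertexAt_symmDiff_succ {δ : ℕ → ℕ} {N : ℕ} {t : ℕ} (hδ : δ t ∈ Finset.Icc 1 N) :
    vertexAt δ N t ∆ vertexAt δ N (t + 1) = {δ t} := by
  ext i
  simp only [vertexAt, Finset.mem_symmDiff, Finset.mem_filter, Finset.mem_singleton, Nat.count_succ]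
  by_cases h : δ t = i
  · subst h
    simp only [hδ, true_and, if_true, Nat.odd_add_one, not_not, and_self, iff_true]
    exact em _
  · simp only [h, Ne.symm h, if_false, add_zero]
    tauto

theorem isHamPath_vertexAt {δ : ℕ → ℕ} {N : ℕ} (hδ : ∀ t, δ t ∈ Finset.Icc 1 N)
    (hinj : ∀ t < 2 ^ N, ∀ t' < 2 ^ N, (∀ i ∈ Finset.Icc 1 N,
      Nat.count (fun τ => δ τ = i) t ≡ Nat.count (fun τ => δ τ = i) t' [MOD 2]) → t = t') :
    IsHamPath N ((List.range (2 ^ N)).map (vertexAt δ N)) := by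
  refine ⟨fun s hs => ?_, ?_, by simp, ?_⟩
  · obtain ⟨t, -, rfl⟩ := List.mem_map.1 hs
    exact Finset.filter_subset ..
  · refine List.Nodup.map_on (fun t ht t' ht' h => ?_) List.nodup_range
    refine hinj t (List.mem_range.1 ht) t' (List.mem_range.1 ht') fun i hi => ?_
    have := Finset.ext_iff.1 h i
    simp only [vertexAt, Finset.mem_filter, hi, true_and, Nat.odd_iff] at this
    unfold Nat.ModEq
    omega
  · rw [List.Chain', List.isChain_map, List.isChain_range]
    exact fun t _ => ⟨δ t, vertexAt_symmDiff_succ (hδ t)⟩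

theorem flipSeq_vertexAt {δ : ℕ → ℕ} {N : ℕ} (hδ : ∀ t, δ t ∈ Finset.Icc 1 N) (L : ℕ) :
    flipSeq ((List.range L).map (vertexAt δ N)) = (List.range (L - 1)).map δ := by
  refine List.ext_getElem (by simp [flipSeq]) fun t h _ => ?_
  simp [flipSeq, vertexAt_symmDiff_succ (hδ t)]

/-- The direction flipped at time `t` by a Hamiltonian cycle of `Q_{2^k}`: by default the
directions `1, …, 2^k` are repeated cyclically, but at the carries into class `v` the direction
`2 ^ v` is replaced by another one with the same `2`-adic valuation. -/
def flipDir (k t : ℕ) : ℕ :=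
  if ruler k t + 2 ≤ k ∧ t % 2 ^ carryExp k (ruler k t) + 1 = 2 ^ ruler k t then
    2 ^ ruler k t * (2 * (ruler (2 ^ (k - 1 - ruler k t) - 2)
      (t / 2 ^ carryExp k (ruler k t)) + 1) + 1)
  else t % 2 ^ k + 1

theorem le_carryExp (k v : ℕ) : k + 1 ≤ carryExp k v := Nat.le_add_right ..

theorem mod_two_pow_of_mod_carryExp {k v t : ℕ} (hv : v < k)
    (h : t % 2 ^ carryExp k v + 1 = 2 ^ v) {e : ℕ} (hke : k ≤ e) (he : e ≤ carryExp k v) :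
    t % 2 ^ e + 1 = 2 ^ v := by
  have hlt : 2 ^ v < 2 ^ e := Nat.pow_lt_pow_right (by norm_num) (by omega)
  rw [← Nat.mod_mod_of_dvd t (pow_dvd_pow 2 he), Nat.mod_eq_of_lt (by omega), h]

theorem two_mul_two_pow_class {k v : ℕ} (hv : v + 2 ≤ k) :
    2 ^ v * (2 * 2 ^ (k - 1 - v)) = 2 ^ k ∧ 2 ≤ 2 ^ (k - 1 - v) := by
  refine ⟨?_, ?_⟩
  · rw [← pow_succ', ← pow_add]
    congr 1
    omega
  · exact Nat.le_self_pow (by omega) 2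

theorem padicValNat_flipDir (k t : ℕ) : padicValNat 2 (flipDir k t) = ruler k t := by
  rw [flipDir]
  split_ifs
  · exact padicValNat_two_pow_mul_odd ..
  · exact padicValNat_mod_two_pow_succ k t

theorem flipDir_mem (k t : ℕ) : flipDir k t ∈ Finset.Icc 1 (2 ^ k) := by
  rw [flipDir, Finset.mem_Icc]
  split_ifs with h
  · obtain ⟨h1, h2⟩ := two_mul_two_pow_class h.1
    have := ruler_le (2 ^ (k - 1 - ruler k t) - 2) (t / 2 ^ carryExp k (ruler k t))
    refine ⟨Nat.mul_pos (by positivity) (by omega), ?_⟩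
    conv_rhs => rw [← h1]
    exact Nat.mul_le_mul_left _ (by omega)
  · exact ⟨by omega, Nat.mod_lt _ (by positivity)⟩

theorem two_pow_mul_odd_ne_two_pow (v u : ℕ) : 2 ^ v * (2 * (u + 1) + 1) ≠ 2 ^ v := by
  have := Nat.two_pow_pos v
  intro h
  nlinarith

theorem flipDir_eq_iff {k v u : ℕ} (hv : v + 2 ≤ k) (t : ℕ) :
    flipDir k t = 2 ^ v * (2 * (u + 1) + 1) ↔
      t % 2 ^ k + 1 = 2 ^ v * (2 * (u + 1) + 1) ∨
        t % 2 ^ carryExp k v + 1 = 2 ^ v ∧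
          ruler (2 ^ (k - 1 - v) - 2) (t / 2 ^ carryExp k v) = u := by
  constructor
  · intro h
    have hr : ruler k t = v := by
      rw [← padicValNat_flipDir, h, padicValNat_two_pow_mul_odd]
    rw [flipDir, hr] at h
    split_ifs at h with hc
    · refine Or.inr ⟨hc.2, ?_⟩
      have := Nat.eq_of_mul_eq_mul_left (Nat.two_pow_pos v) h
      omega
    · exact Or.inl h
  · rintro (h | ⟨h, rfl⟩)
    · have hr : ruler k t = v := by
        rw [← padicValNat_mod_two_pow_succ, h, padicValNat_two_pow_mul_odd]
      rw [flipDir, hr, if_neg, h]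
      rintro ⟨-, hc⟩
      have := mod_two_pow_of_mod_carryExp (by omega) hc le_rfl (by have := le_carryExp k v; omega)
      exact two_pow_mul_odd_ne_two_pow v u (h ▸ this)
    · have h' := mod_two_pow_of_mod_carryExp (by omega) h le_rfl
        (by have := le_carryExp k v; omega)
      have hr : ruler k t = v := by
        rw [← padicValNat_mod_two_pow_succ, h', padicValNat.prime_pow]
      rw [flipDir, hr, if_pos ⟨hv, h⟩]

theorem count_or_of_disjoint (p q : ℕ → Prop) [DecidablePred p] [DecidablePred q]
    (h : ∀ t, p t → ¬ q t) (t : ℕ) :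
    Nat.count (fun τ => p τ ∨ q τ) t = Nat.count p t + Nat.count q t := by
  induction t with
  | zero => simp
  | succ t ih =>
    simp only [Nat.count_succ, ih]
    by_cases hp : p t
    · simp [hp, h t hp]; omega
    · by_cases hq : q t <;> simp [hp, hq]; omega

theorem count_flipDir {k v u : ℕ} (hv : v + 2 ≤ k) (hu : u + 2 ≤ 2 ^ (k - 1 - v)) (t : ℕ) :
    Nat.count (fun τ => flipDir k τ = 2 ^ v * (2 * (u + 1) + 1)) t =
      (t + (2 ^ k - 2 ^ v * (2 * (u + 1) + 1))) / 2 ^ k +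
        Nat.count (fun τ => ruler (2 ^ (k - 1 - v) - 2) τ = u)
          ((t + (2 ^ carryExp k v - 2 ^ v)) / 2 ^ carryExp k v) := by
  have hke := le_carryExp k v
  have hpos := Nat.two_pow_pos v
  have hlt : 2 ^ v < 2 ^ carryExp k v := Nat.pow_lt_pow_right (by norm_num) (by omega)
  have hle : 2 ^ v * (2 * (u + 1) + 1) ≤ 2 ^ k := by
    conv_rhs => rw [← (two_mul_two_pow_class hv).1]
    exact Nat.mul_le_mul_left _ (by omega)
  have hge : 0 < 2 ^ v * (2 * (u + 1) + 1) := by positivity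
  have h1 := count_mod_eq_and (fun _ => True)
    (show 2 ^ v * (2 * (u + 1) + 1) - 1 < 2 ^ k by omega) t
  have h2 := count_mod_eq_and (fun τ => ruler (2 ^ (k - 1 - v) - 2) τ = u)
    (show 2 ^ v - 1 < 2 ^ carryExp k v by omega) t
  rw [Nat.count_true, show 2 ^ k - 1 - (2 ^ v * (2 * (u + 1) + 1) - 1) =
    2 ^ k - 2 ^ v * (2 * (u + 1) + 1) by omega] at h1
  rw [show 2 ^ carryExp k v - 1 - (2 ^ v - 1) = 2 ^ carryExp k v - 2 ^ v by omega] at h2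
  rw [← h1, ← h2, ← count_or_of_disjoint]
  · congr 1
    ext τ
    rw [flipDir_eq_iff hv]
    have e1 : ∀ x y : ℕ, 0 < y → (x + 1 = y ↔ x = y - 1) := by omega
    rw [e1 _ _ hge, e1 _ _ hpos, and_true]
  · rintro τ ⟨h, -⟩ ⟨h', -⟩
    have := mod_two_pow_of_mod_carryExp (t := τ) (v := v) (by omega) (by omega) le_rfl
      (by omega : k ≤ _)
    exact two_pow_mul_odd_ne_two_pow v u (by omega)

theorem count_padicValNat_flipDir {k v : ℕ} (t : ℕ) :
    Nat.count (fun τ => ruler k τ = v) t =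
      ∑ i ∈ Finset.Icc 1 (2 ^ k) with padicValNat 2 i = v,
        Nat.count (fun τ => flipDir k τ = i) t := by
  induction t with
  | zero => simp
  | succ t ih =>
    simp only [Nat.count_succ, Finset.sum_add_distrib, ih, Finset.sum_ite_eq, Finset.mem_filter,
      flipDir_mem, true_and, padicValNat_flipDir]

theorem modEq_of_count_flipDir {k t t' : ℕ} (hk : 1 ≤ k) (h : ∀ i ∈ Finset.Icc 1 (2 ^ k),
      Nat.count (fun τ => flipDir k τ = i) t ≡ Nat.count (fun τ => flipDir k τ = i) t' [MOD 2]) :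
    t ≡ t' [MOD 2 ^ 2 ^ k] := by
  have hclock : t ≡ t' [MOD 2 ^ (k + 1)] := modEq_of_count_ruler fun v _ => by
    rw [count_padicValNat_flipDir, count_padicValNat_flipDir]
    exact Nat.ModEq.sum fun i hi => h i (Finset.mem_filter.1 hi).1
  have key : ∀ v < k, t ≡ t' [MOD 2 ^ carryExp k v] := by
    intro v
    induction v with
    | zero => exact fun _ => by rwa [carryExp_zero]
    | succ v ih =>
      intro hv
      have ih := ih (by omega)
      obtain ⟨hcard, h2⟩ := two_mul_two_pow_class (k := k) (v := v) (by omega)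
      have hJ : (t + (2 ^ carryExp k v - 2 ^ v)) / 2 ^ carryExp k v ≡
          (t' + (2 ^ carryExp k v - 2 ^ v)) / 2 ^ carryExp k v
            [MOD 2 ^ (2 ^ (k - 1 - v) - 2 + 1)] := by
        refine modEq_of_count_ruler fun u hu => ?_
        have hmem : 2 ^ v * (2 * (u + 1) + 1) ∈ Finset.Icc 1 (2 ^ k) := by
          refine Finset.mem_Icc.2 ⟨Nat.mul_pos (by positivity) (by omega), ?_⟩
          conv_rhs => rw [← hcard]
          exact Nat.mul_le_mul_left _ (by omega)
        have hi := h _ hmem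
        rw [count_flipDir (by omega) (by omega), count_flipDir (by omega) (by omega)] at hi
        refine Nat.ModEq.add_left_cancel (div_modEq_of_mul ?_) hi
        rw [← pow_succ]
        exact hclock.add_right _
      rw [carryExp_succ, pow_add, show 2 ^ (k - 1 - v) - 1 = 2 ^ (k - 1 - v) - 2 + 1 by omega]
      exact (modEq_mul_of_div (ih.add_right _) hJ).add_right_cancel' _
  have := key (k - 1) (by omega)
  rwa [carryExp_pred hk] at this

theorem isHamPath_flipDir {k : ℕ} (hk : 1 ≤ k) :
    IsHamPath (2 ^ k) ((List.range (2 ^ 2 ^ k)).map (vertexAt (flipDir k) (2 ^ k))) :=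
  isHamPath_vertexAt (flipDir_mem k) fun _ ht _ ht' h =>
    (modEq_of_count_flipDir hk h).eq_of_lt_of_lt ht ht'

theorem runNu_map_singleton {ρ : ℕ} {L : List ℕ} (h : ∀ a ∈ L, a ≤ ρ) :
    runNu ρ (L.map fun a => [a]) = L.length := by
  induction L with
  | nil => rfl
  | cons a L ih =>
    rw [List.map_cons, ← List.singleton_append, runNu_append,
      runNu_singleton_of_le (by simpa using h a (by simp)),
      ih fun b hb => h b (List.mem_cons_of_mem _ hb), List.length_cons, add_comm]

theorem runLambda_map_singleton {ρ : ℕ} {L : List ℕ} (h : ∀ a ∈ L, a ≤ ρ) :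
    runLambda ρ (L.map fun a => [a]) = 0 := by
  induction L with
  | nil => rfl
  | cons a L ih =>
    rw [List.map_cons, ← List.singleton_append, runLambda_append,
      runLambda_singleton_of_le (by simpa using h a (by simp)),
      ih fun b hb => h b (List.mem_cons_of_mem _ hb), List.length_singleton]

theorem isRunPartition_map_singleton {ρ : ℕ} {L : List ℕ} (h : ∀ a ∈ L, a ≤ ρ) :
    IsRunPartition ρ L (L.map fun a => [a]) := by
  refine ⟨by rw [← List.flatMap_def, List.flatMap_singleton'], fun b hb => ?_⟩
  obtain ⟨a, ha, rfl⟩ := List.mem_map.1 hb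
  exact Or.inl (.singleton (h a ha))

theorem isRunPartition_run {ρ c L : ℕ} (hL : L ≠ 0) (h : L + c ≤ ρ + 1) :
    IsRunPartition ρ ((List.range L).map (· + c)) [(List.range L).map (· + c)] := by
  refine ⟨by simp, fun b hb => Or.inl ?_⟩
  rw [List.mem_singleton.1 hb]
  refine ⟨by simpa using hL, fun a ha => ?_, Or.inl ?_⟩
  · obtain ⟨s, hs, rfl⟩ := List.mem_map.1 ha
    have := List.mem_range.1 hs
    omega
  · rw [List.Chain', List.isChain_map, List.isChain_range]
    exact fun s _ => by omega

theorem isRunPartition_singleton_of_lt {ρ a : ℕ} (h : ρ < a) : IsRunPartition ρ [a] [[a]] :=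
  ⟨rfl, fun _ hb => Or.inr ⟨a, h, List.mem_singleton.1 hb⟩⟩

theorem IsRunPartition.of_append_singleton {ρ a : ℕ} {σ : List ℕ} {bs : List (List ℕ)}
    (h : IsRunPartition ρ (σ ++ [a]) (bs ++ [[a]])) : IsRunPartition ρ σ bs :=
  ⟨by simpa using h.1, fun b hb => h.2 b (by simp [hb])⟩

theorem flipDir_eq_two_pow_iff (k t : ℕ) : flipDir k t = 2 ^ k ↔ t % 2 ^ k + 1 = 2 ^ k := by
  have hlt := Nat.mod_lt t (Nat.two_pow_pos k)
  constructor <;> intro h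
  · have h1 : ruler k t = k := by rw [← padicValNat_flipDir, h, padicValNat.prime_pow]
    rw [← padicValNat_mod_two_pow_succ] at h1
    have h2 : 2 ^ padicValNat 2 (t % 2 ^ k + 1) ∣ t % 2 ^ k + 1 := pow_padicValNat_dvd
    rw [h1] at h2
    have := Nat.le_of_dvd (by omega) h2
    omega
  · have h1 : ruler k t = k := by rw [← padicValNat_mod_two_pow_succ, h, padicValNat.prime_pow]
    rw [flipDir, if_neg (by rw [h1]; omega), h]

theorem flipDir_second_half {k s : ℕ} (hs : s < 2 ^ k) (j : ℕ) :
    flipDir k (2 ^ (k + 1) * j + 2 ^ k + s) = s + 1 := by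
  have hmod : (2 ^ (k + 1) * j + 2 ^ k + s) % 2 ^ (k + 1) = 2 ^ k + s := by
    rw [add_assoc, Nat.mul_add_mod, Nat.mod_eq_of_lt]
    rw [pow_succ]
    omega
  rw [flipDir, if_neg]
  · rw [pow_succ, mul_assoc, ← mul_add_one, Nat.mul_add_mod, Nat.mod_eq_of_lt hs]
  · rintro ⟨h, h'⟩
    have h1 := mod_two_pow_of_mod_carryExp (by omega) h' (by omega) (le_carryExp ..)
    have h2 := Nat.pow_lt_pow_right (a := 2) (by norm_num)
      (show ruler k (2 ^ (k + 1) * j + 2 ^ k + s) < k by omega)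
    omega

theorem flipDir_first_half {k s j : ℕ} (hs : s < 2 ^ k) (hs0 : s ≠ 0)
    (hj : ¬ 2 ^ (2 ^ (k - 1) - 1) ∣ j) : flipDir k (2 ^ (k + 1) * j + s) = s + 1 := by
  have hs' : s < 2 ^ (k + 1) := by rw [pow_succ]; omega
  have hmod : (2 ^ (k + 1) * j + s) % 2 ^ k = s := by
    rw [pow_succ, mul_assoc, Nat.mul_add_mod, Nat.mod_eq_of_lt hs]
  rw [flipDir, hmod, if_neg]
  rintro ⟨h, h'⟩
  have hke := le_carryExp k (ruler k (2 ^ (k + 1) * j + s))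
  have h1 := mod_two_pow_of_mod_carryExp (by omega) h' le_rfl (by omega)
  have hv : ruler k (2 ^ (k + 1) * j + s) ≠ 0 := fun h0 => by
    rw [h0] at h1
    omega
  have hc : carryExp k 1 = k + 1 + (2 ^ (k - 1) - 1) := by
    rw [show 1 = 0 + 1 from rfl, carryExp_succ, carryExp_zero, Nat.sub_zero]
  have h2 := mod_two_pow_of_mod_carryExp (by omega) h' (by omega)
    (carryExp_mono k (Nat.one_le_iff_ne_zero.2 hv))
  have h3 : (2 ^ (k + 1) * j + s) % 2 ^ carryExp k 1 = s := by omega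
  refine hj (Nat.dvd_of_mod_eq_zero ?_)
  have h4 := Nat.mod_mul_right_div_self (2 ^ (k + 1) * j + s) (2 ^ (k + 1)) (2 ^ (2 ^ (k - 1) - 1))
  rwa [← pow_add, ← hc, h3, Nat.div_eq_of_lt hs', Nat.mul_add_div (Nat.two_pow_pos _),
    Nat.div_eq_of_lt hs', add_zero, eq_comm] at h4

/-- The blocks of the flip sequence `flipDir k` between the times `2 ^ (k + 1) * j` and
`2 ^ (k + 1) * (j + 1)`, without the last one, which is `[2 ^ k]`. -/
def cycleBlocks (k j : ℕ) : List (List ℕ) :=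
  (if 2 ^ (2 ^ (k - 1) - 1) ∣ j then
    ((List.range (2 ^ k - 1)).map fun s => flipDir k (2 ^ (k + 1) * j + s)).map fun a => [a]
  else [[flipDir k (2 ^ (k + 1) * j)]] ++ [(List.range (2 ^ k - 2)).map (· + 2)]) ++
    ([[2 ^ k]] ++ [(List.range (2 ^ k - 1)).map (· + 1)])

theorem flipDir_le_of_lt {k s : ℕ} (hs : s < 2 ^ k - 1) (j : ℕ) :
    flipDir k (2 ^ (k + 1) * j + s) ≤ 2 ^ k - 1 := by
  have h1 := (Finset.mem_Icc.1 (flipDir_mem k (2 ^ (k + 1) * j + s))).2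
  have h2 : flipDir k (2 ^ (k + 1) * j + s) ≠ 2 ^ k := by
    rw [Ne, flipDir_eq_two_pow_iff, pow_succ, mul_assoc, Nat.mul_add_mod,
      Nat.mod_eq_of_lt (by omega)]
    omega
  omega

theorem forall_mem_first_half_le (k j : ℕ) :
    ∀ a ∈ (List.range (2 ^ k - 1)).map fun s => flipDir k (2 ^ (k + 1) * j + s),
      a ≤ 2 ^ k - 1 := by
  intro a ha
  obtain ⟨s, hs, rfl⟩ := List.mem_map.1 ha
  exact flipDir_le_of_lt (List.mem_range.1 hs) j

theorem forall_mem_run_le {L c ρ : ℕ} (h : L + c ≤ ρ + 1) :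
    ∀ a ∈ (List.range L).map (· + c), a ≤ ρ := by
  intro a ha
  obtain ⟨s, hs, rfl⟩ := List.mem_map.1 ha
  have := List.mem_range.1 hs
  omega

theorem range_map_flipDir_cycle (k j : ℕ) :
    (List.range (2 ^ (k + 1))).map (fun s => flipDir k (2 ^ (k + 1) * j + s)) =
      ((List.range (2 ^ k - 1)).map fun s => flipDir k (2 ^ (k + 1) * j + s)) ++
        ([2 ^ k] ++ (List.range (2 ^ k - 1)).map (· + 1)) ++ [2 ^ k] := by
  have hpos := Nat.two_pow_pos k
  have hn : List.range (2 ^ k) = List.range (2 ^ k - 1) ++ [2 ^ k - 1] := by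
    conv_lhs => rw [← Nat.sub_add_cancel hpos, List.range_succ]
  have h1 : (List.range (2 ^ k)).map (fun s => flipDir k (2 ^ (k + 1) * j + s)) =
      ((List.range (2 ^ k - 1)).map fun s => flipDir k (2 ^ (k + 1) * j + s)) ++ [2 ^ k] := by
    rw [hn, List.map_append, List.map_singleton, (flipDir_eq_two_pow_iff k _).2]
    rw [pow_succ, mul_assoc, Nat.mul_add_mod, Nat.mod_eq_of_lt (by omega)]
    omega
  have h2 : (List.range (2 ^ k)).map (fun s => flipDir k (2 ^ (k + 1) * j + (2 ^ k + s))) =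
      (List.range (2 ^ k - 1)).map (· + 1) ++ [2 ^ k] := by
    rw [List.map_congr_left (g := (· + 1)) fun s hs => by
      rw [← add_assoc, flipDir_second_half (List.mem_range.1 hs)]]
    rw [hn, List.map_append, List.map_singleton, Nat.sub_add_cancel hpos]
  rw [pow_succ 2 k, mul_two, List.range_add, List.map_append, List.map_map, ← mul_two, ← pow_succ,
    h1]
  simp only [Function.comp_def]
  rw [h2]
  simp

theorem isRunPartition_cycleBlocks {k : ℕ} (hk : 2 ≤ k) (j : ℕ) :
    IsRunPartition (2 ^ k - 1)
      (((List.range (2 ^ k - 1)).map fun s => flipDir k (2 ^ (k + 1) * j + s)) ++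
        ([2 ^ k] ++ (List.range (2 ^ k - 1)).map (· + 1))) (cycleBlocks k j) := by
  have h4 : 2 ^ 2 ≤ 2 ^ k := Nat.pow_le_pow_right (by norm_num) hk
  refine IsRunPartition.append ?_ ((isRunPartition_singleton_of_lt (by omega)).append
    (isRunPartition_run (by omega) (by omega)))
  split_ifs with hj
  · exact isRunPartition_map_singleton (forall_mem_first_half_le k j)
  · have hsplit : ((List.range (2 ^ k - 1)).map fun s => flipDir k (2 ^ (k + 1) * j + s)) =
        [flipDir k (2 ^ (k + 1) * j)] ++ (List.range (2 ^ k - 2)).map (· + 2) := by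
      rw [show 2 ^ k - 1 = 1 + (2 ^ k - 2) by omega, List.range_add, List.map_append, List.map_map]
      congr 1
      refine List.map_congr_left fun s hs => ?_
      have := List.mem_range.1 hs
      simp only [Function.comp_apply]
      rw [flipDir_first_half (by omega) (by omega) hj]
      omega
    rw [hsplit]
    refine IsRunPartition.append ⟨rfl, fun b hb => Or.inl ?_⟩
      (isRunPartition_run (by omega) (by omega))
    rw [List.mem_singleton.1 hb]
    exact .singleton (flipDir_le_of_lt (s := 0) (by omega) j)

theorem runNu_cycleBlocks {k : ℕ} (hk : 2 ≤ k) (j : ℕ) :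
    runNu (2 ^ k - 1) (cycleBlocks k j) = if 2 ^ (2 ^ (k - 1) - 1) ∣ j then 2 ^ k else 3 := by
  have h4 : 2 ^ 2 ≤ 2 ^ k := Nat.pow_le_pow_right (by norm_num) hk
  rw [cycleBlocks, runNu_append, runNu_append, runNu_singleton_of_lt (by omega),
    runNu_singleton_of_le (forall_mem_run_le (by omega))]
  split_ifs
  · rw [runNu_map_singleton (forall_mem_first_half_le k j)]
    simp only [List.length_map, List.length_range]
    omega
  · rw [runNu_append, runNu_singleton_of_le (forall_mem_run_le (by omega)),
      runNu_singleton_of_le]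
    simpa using flipDir_le_of_lt (s := 0) (by omega) j

theorem runNu_add_runLambda_cycleBlocks {k : ℕ} (hk : 2 ≤ k) (j : ℕ) :
    runNu (2 ^ k - 1) (cycleBlocks k j) + runLambda (2 ^ k - 1) (cycleBlocks k j) =
      2 * 2 ^ k - 2 := by
  have h4 : 2 ^ 2 ≤ 2 ^ k := Nat.pow_le_pow_right (by norm_num) hk
  rw [runNu_cycleBlocks hk, cycleBlocks, runLambda_append, runLambda_append,
    runLambda_singleton_of_lt (by omega), runLambda_singleton_of_le (forall_mem_run_le (by omega))]
  split_ifs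
  · rw [runLambda_map_singleton (forall_mem_first_half_le k j)]
    simp only [List.length_map, List.length_range]
    omega
  · rw [runLambda_append, runLambda_singleton_of_le (forall_mem_run_le (by omega)),
      runLambda_singleton_of_le]
    · simp only [List.length_map, List.length_range, List.length_singleton]
      omega
    · simpa using flipDir_le_of_lt (s := 0) (by omega) j

theorem exists_isRunPartition_flipDir {k : ℕ} (hk : 2 ≤ k) (K : ℕ) :
    ∃ bs, IsRunPartition (2 ^ k - 1) ((List.range (2 ^ (k + 1) * K)).map (flipDir k)) bs ∧
      runNu (2 ^ k - 1) bs =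
        ∑ j ∈ Finset.range K, (if 2 ^ (2 ^ (k - 1) - 1) ∣ j then 2 ^ k else 3) ∧
      runNu (2 ^ k - 1) bs + runLambda (2 ^ k - 1) bs = K * (2 * 2 ^ k - 2) := by
  have hpos := Nat.two_pow_pos k
  induction K with
  | zero => exact ⟨[], ⟨rfl, by simp⟩, rfl, by simp [runNu, runLambda, runBlocks]⟩
  | succ K ih =>
    obtain ⟨bs, h, hν, hlam⟩ := ih
    refine ⟨bs ++ (cycleBlocks k K ++ [[2 ^ k]]), ?_, ?_, ?_⟩
    · rw [mul_add_one, List.range_add, List.map_append, List.map_map, Function.comp_def,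
        range_map_flipDir_cycle]
      exact h.append ((isRunPartition_cycleBlocks hk K).append
        (isRunPartition_singleton_of_lt (by omega)))
    · rw [runNu_append, runNu_append, runNu_singleton_of_lt (by omega), hν, runNu_cycleBlocks hk,
        Finset.sum_range_succ, add_zero]
    · rw [runNu_append, runNu_append, runNu_singleton_of_lt (by omega), runLambda_append,
        runLambda_append, runLambda_singleton_of_lt (by omega), add_one_mul, ← hlam,
        ← runNu_add_runLambda_cycleBlocks hk K]
      omega

/-- The last block of the partition of a full period can be dropped, as it exceeds `2 ^ k - 1`. -/
theorem exists_isRunPartition_flipDir_pred {k K : ℕ} (hk : 2 ≤ k) (hK : 0 < K) :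
    ∃ bs, IsRunPartition (2 ^ k - 1) ((List.range (2 ^ (k + 1) * K - 1)).map (flipDir k)) bs ∧
      runNu (2 ^ k - 1) bs =
        ∑ j ∈ Finset.range K, (if 2 ^ (2 ^ (k - 1) - 1) ∣ j then 2 ^ k else 3) ∧
      runNu (2 ^ k - 1) bs + runLambda (2 ^ k - 1) bs = K * (2 * 2 ^ k - 2) := by
  have hpos := Nat.two_pow_pos k
  obtain ⟨K, rfl⟩ := Nat.exists_eq_add_one.2 hK
  obtain ⟨bs, h, hν, hlam⟩ := exists_isRunPartition_flipDir hk K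
  refine ⟨bs ++ cycleBlocks k K, IsRunPartition.of_append_singleton (a := 2 ^ k) ?_, ?_, ?_⟩
  · have hlast : flipDir k (2 ^ (k + 1) * (K + 1) - 1) = 2 ^ k := by
      rw [flipDir_eq_two_pow_iff, show 2 ^ (k + 1) * (K + 1) - 1 =
        2 ^ k * (2 * K + 1) + (2 ^ k - 1) by rw [pow_succ, mul_add_one, mul_add_one, mul_assoc]; omega,
        Nat.mul_add_mod, Nat.mod_eq_of_lt (by omega)]
      omega
    have hσ : (List.range (2 ^ (k + 1) * (K + 1) - 1)).map (flipDir k) ++ [2 ^ k] =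
        (List.range (2 ^ (k + 1) * (K + 1))).map (flipDir k) := by
      rw [← hlast, ← List.map_singleton, ← List.map_append, ← List.range_succ, Nat.succ_eq_add_one,
        Nat.sub_add_cancel (Nat.mul_pos (Nat.two_pow_pos _) (Nat.succ_pos K))]
    rw [hσ, List.append_assoc, mul_add_one, List.range_add, List.map_append, List.map_map,
      Function.comp_def, range_map_flipDir_cycle]
    exact h.append ((isRunPartition_cycleBlocks hk K).append
      (isRunPartition_singleton_of_lt (by omega)))
  · rw [runNu_append, hν, runNu_cycleBlocks hk, Finset.sum_range_succ]
  · rw [runNu_append, runLambda_append, add_one_mul, ← hlam,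
      ← runNu_add_runLambda_cycleBlocks hk K]
    omega

theorem sum_range_ite_dvd {B : ℕ} (hB : 0 < B) (a c K : ℕ) :
    ∑ j ∈ Finset.range (B * K), (if B ∣ j then a else c) = K * (a + (B - 1) * c) := by
  induction K with
  | zero => simp
  | succ K ih =>
    rw [mul_add_one, Finset.sum_range_add, ih, add_one_mul]
    congr 1
    obtain ⟨B, rfl⟩ := Nat.exists_eq_add_one.2 hB
    rw [Finset.sum_range_succ', Finset.sum_congr rfl (g := fun _ => c)]
    · simp [add_comm]
    · intro x hx
      rw [if_neg]
      rw [Nat.dvd_add_right (dvd_mul_right ..)]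
      exact Nat.not_dvd_of_pos_of_lt (by omega) (by simpa using hx)

theorem succ_le_two_pow_pred {k : ℕ} (hk : 3 ≤ k) : k + 1 ≤ 2 ^ (k - 1) := by
  obtain ⟨d, rfl⟩ := Nat.exists_eq_add_of_le' hk
  have h : d < 2 ^ d := Nat.lt_two_pow_self
  rw [show d + 3 - 1 = d + 2 by omega, pow_add]
  omega

theorem exists_isHamPath_two_pow {k : ℕ} (hk : 3 ≤ k) :
    ∃ l bs K, IsHamPath (2 ^ k) l ∧ IsRunPartition (2 ^ k - 1) (flipSeq l) bs ∧
      2 ^ 2 ^ k = 8 * 2 ^ k * K ∧ runNu (2 ^ k - 1) bs + 4 = 17 * K ∧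
      runNu (2 ^ k - 1) bs + runLambda (2 ^ k - 1) bs = 4 * K * (2 * 2 ^ k - 2) := by
  have hp := succ_le_two_pow_pred hk
  have hn : 2 ^ k = 2 * 2 ^ (k - 1) := by rw [← pow_succ', Nat.sub_add_cancel (by omega)]
  have h8 : 8 ≤ 2 ^ k := by omega
  set B := 2 ^ (2 ^ (k - 1) - 1) with hB
  set K' := 2 ^ (2 ^ (k - 1) - k) with hK'
  set K := 2 ^ (2 ^ k - k - 3) with hK
  have hBK : B * K' = 4 * K := by
    rw [hB, hK', hK, ← pow_add, show 4 = 2 ^ 2 by norm_num, ← pow_add]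
    congr 1
    omega
  have hNK : 2 ^ 2 ^ k = 2 ^ (k + 1) * (B * K') := by
    rw [hBK, hK, show 4 = 2 ^ 2 by norm_num, ← pow_add, ← pow_add]
    congr 1
    omega
  have hBn : 2 ^ k ≤ B := Nat.pow_le_pow_right (by norm_num) (by omega)
  have hK4 : 4 ≤ K := by
    calc 4 = 2 ^ 2 := by norm_num
      _ ≤ K := Nat.pow_le_pow_right (by norm_num) (by omega)
  have hBK0 : 0 < B * K' := by omega
  obtain ⟨bs, h, hν, hlam⟩ := exists_isRunPartition_flipDir_pred (k := k) (by omega) hBK0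
  rw [← hB, sum_range_ite_dvd (by omega)] at hν
  have hν' : runNu (2 ^ k - 1) bs + 4 ≤ 17 * K := by
    have h1 : K' * (2 ^ k + (B - 1) * 3) ≤ K' * (4 * B) := Nat.mul_le_mul_left _ (by omega)
    have h2 : K' * (4 * B) = 16 * K := by linear_combination 4 * hBK
    omega
  have hlow : 17 * K ≤ runNu (2 ^ k - 1) bs + runLambda (2 ^ k - 1) bs := by
    rw [hlam, hBK]
    have : 4 * K * 14 ≤ 4 * K * (2 * 2 ^ k - 2) := Nat.mul_le_mul_left _ (by omega)
    omega
  obtain ⟨bs', h', hν₁, hlam₁⟩ :=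
    h.exists_refine (17 * K - 4 - runNu (2 ^ k - 1) bs) (by omega)
  refine ⟨_, bs', K, isHamPath_flipDir (by omega), ?_, ?_, by omega, ?_⟩
  · rwa [flipSeq_vertexAt (flipDir_mem k), hNK]
  · rw [hNK, hBK, pow_succ]
    ring
  · rw [← hBK, ← hlam]
    omega

/-- Corollary 3.2: for `k ≥ 2`, `n = 2^k` and `0 ≤ m < n` there is a Hamiltonian path `P`
in `Q_{n+m}` with an `(n−1)`-run partition of its flip sequence with `ν = 6·2^m`,
`λ = 8·2^m` if `k = 2`, and `ν = ((17/8)·(2^n/n) − 4)·2^m`,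
`λ = (2^n − (25/8)·(2^n/n) + 4)·2^m` if `k ≥ 3`
(the `k ≥ 3` equations are stated multiplied through by `8n`). -/
theorem stmt_12 (k : ℕ) (hk : 2 ≤ k) (n : ℕ) (hn : n = 2 ^ k) (m : ℕ) (hm : m < n) :
    ∃ (l : List (Finset ℕ)) (bs : List (List ℕ)),
      IsHamPath (n + m) l ∧ IsRunPartition (n - 1) (flipSeq l) bs ∧
      (k = 2 → runNu (n - 1) bs = 6 * 2 ^ m ∧ runLambda (n - 1) bs = 8 * 2 ^ m) ∧
      (3 ≤ k →
        8 * n * runNu (n - 1) bs + 32 * n * 2 ^ m = 17 * 2 ^ n * 2 ^ m ∧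
        8 * n * runLambda (n - 1) bs + 25 * 2 ^ n * 2 ^ m
          = (8 * n * 2 ^ n + 32 * n) * 2 ^ m) := by
  subst hn
  rcases (show k = 2 ∨ 3 ≤ k by omega) with rfl | hk3
  · obtain ⟨l, bs, hl, hbs, hν, hlam⟩ := exists_isHamPath_three
    obtain ⟨l', bs', hl', hbs', hν', hlam'⟩ := hl.exists_double_iterate hbs le_rfl (m + 1)
    rw [hν] at hν'
    rw [hlam] at hlam'
    refine ⟨l', bs', by rwa [show 2 ^ 2 + m = 3 + (m + 1) by omega], hbs', fun _ => ⟨?_, ?_⟩,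
      fun h => by omega⟩
    · exact hν'.trans (by ring)
    · exact hlam'.trans (by ring)
  · obtain ⟨l, bs, K, hl, hbs, hK, hν, hlam⟩ := exists_isHamPath_two_pow hk3
    obtain ⟨l', bs', hl', hbs', hν', hlam'⟩ := hl.exists_double_iterate hbs (by omega) m
    refine ⟨l', bs', hl', hbs', fun h => by omega, fun _ => ?_⟩
    have h1 : 1 ≤ 2 ^ k := Nat.one_le_two_pow
    have h2 : 2 * 2 ^ k - 2 + 2 = 2 * 2 ^ k := by omega
    rw [hν', hlam', hK]
    zify at hν hlam h2 ⊢
    constructor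
    · linear_combination 8 * 2 ^ k * 2 ^ m * hν
    · linear_combination 8 * 2 ^ k * 2 ^ m * (hlam - hν) + 32 * K * 2 ^ k * 2 ^ m * h2
end

section
/- Let n ≥ 2, let P be any Hamiltonian path in the hypercube Q_n, and consider any (n−1)-run partition of its flip sequence, with parameters ν and λ. Then ν + 2λ ≤ 2·2^n − 2^n/n (equivalently, n·(ν + 2λ) ≤ 2n·2^n − 2^n). -/
open scoped symmDiff

theorem one_le_of_mem_flipSeq {n : ℕ} {l : List (Finset ℕ)} (hl : IsHamPath n l)
    {a : ℕ} (ha : a ∈ flipSeq l) : 1 ≤ a := by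
  obtain ⟨hsub, -, -, hchain⟩ := hl
  unfold flipSeq at ha
  rw [List.mem_map] at ha
  obtain ⟨⟨s, t⟩, hp, rfl⟩ := ha
  have hadj : ∃ d, s ∆ t = {d} := by
    obtain ⟨i, hi, hst⟩ := List.mem_iff_getElem.1 hp
    simp only [List.getElem_zip, List.getElem_tail, Prod.mk.injEq] at hst
    rw [← hst.1, ← hst.2]
    have hi' : i + 1 < l.length := by
      simp only [List.length_zip, List.length_tail] at hi
      omega
    exact List.isChain_iff_getElem.1 hchain i hi'
  obtain ⟨d, hd⟩ := hadj
  have hs := hsub s (List.of_mem_zip hp).1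
  have ht := hsub t (List.mem_of_mem_tail (List.of_mem_zip hp).2)
  have hmem : d ∈ s ∆ t := by simp [hd]
  simp only [hd, Finset.sum_singleton, id]
  rcases Finset.mem_symmDiff.1 hmem with h | h
  · exact (Finset.mem_Icc.1 (hs h.1)).1
  · exact (Finset.mem_Icc.1 (ht h.1)).1

theorem IsRunBlock.nodup {ρ : ℕ} {b : List ℕ} (hb : IsRunBlock ρ b) : b.Nodup := by
  obtain ⟨-, -, h | h⟩ := hb
  · have h' : b.IsChain (· < ·) := h.imp fun _ _ h => by omega
    exact (List.isChain_iff_pairwise.1 h').imp fun h => h.ne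
  · have h' : b.IsChain (· > ·) := h.imp fun _ _ h => by omega
    exact (List.isChain_iff_pairwise.1 h').imp fun h => h.ne'

theorem IsRunBlock.length_le {ρ : ℕ} {b : List ℕ} (hb : IsRunBlock ρ b)
    (hpos : ∀ a ∈ b, 1 ≤ a) : b.length ≤ ρ := by
  have hsub : b.toFinset ⊆ Finset.Icc 1 ρ := fun a ha => by
    rw [List.mem_toFinset] at ha
    exact Finset.mem_Icc.2 ⟨hpos a ha, hb.2.1 a ha⟩
  simpa [List.toFinset_card_of_nodup hb.nodup] using Finset.card_le_card hsub

/-- A run of length `m ≤ n` contributes `2 * m - 1 ≤ (2 - 1 / n) * m` to `ν + 2 * λ`. -/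
theorem mul_runNu_add_runLambda_le {n ρ : ℕ} (hn : 1 ≤ n) (hρ : ρ ≤ n) (bs : List (List ℕ))
    (hbs : ∀ b ∈ bs, IsRunBlock ρ b ∨ ∃ a, ρ < a ∧ b = [a])
    (hpos : ∀ a ∈ bs.flatten, 1 ≤ a) :
    n * (runNu ρ bs + 2 * runLambda ρ bs) ≤ (2 * n - 1) * bs.flatten.length := by
  induction bs with
  | nil => simp [runNu, runLambda, runBlocks]
  | cons b bs ih =>
    have ih' := ih (fun c hc => hbs c (List.mem_cons_of_mem _ hc)) fun a ha =>
      hpos a (by rw [List.flatten_cons]; exact List.mem_append_right _ ha)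
    rw [List.flatten_cons, List.length_append]
    rcases hbs b List.mem_cons_self with hb | ⟨a, ha, rfl⟩
    · have hlen : b.length ≤ ρ := hb.length_le fun a ha =>
        hpos a (by rw [List.flatten_cons]; exact List.mem_append_left _ ha)
      have hall : (b.all fun a => decide (a ≤ ρ)) = true := by simpa using hb.2.1
      have hblocks : runBlocks ρ (b :: bs) = b :: runBlocks ρ bs := List.filter_cons_of_pos hall
      have hν : runNu ρ (b :: bs) = runNu ρ bs + 1 := by simp [runNu, hblocks]
      have hlam : runLambda ρ (b :: bs) = (b.length - 1) + runLambda ρ bs := by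
        simp [runLambda, hblocks]
      obtain ⟨m, hm⟩ : ∃ m, b.length = m + 1 :=
        Nat.exists_eq_succ_of_ne_zero (by simpa using hb.1)
      obtain ⟨k, rfl⟩ : ∃ k, n = k + 1 := Nat.exists_eq_succ_of_ne_zero (by omega)
      have hk : 2 * (k + 1) - 1 = 2 * k + 1 := by omega
      rw [hk] at ih' ⊢
      rw [hν, hlam, hm, Nat.add_sub_cancel]
      nlinarith
    · have hblocks : runBlocks ρ ([a] :: bs) = runBlocks ρ bs :=
        List.filter_cons_of_neg (by simpa using ha)
      have hν : runNu ρ ([a] :: bs) = runNu ρ bs := by simp [runNu, hblocks]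
      have hlam : runLambda ρ ([a] :: bs) = runLambda ρ bs := by simp [runLambda, hblocks]
      rw [hν, hlam]
      exact ih'.trans (Nat.mul_le_mul_left _ (Nat.le_add_left _ _))

/-- For any Hamiltonian path in `Q_n`, `n ≥ 2`, and any `(n−1)`-run partition of its flip
sequence with parameters `ν` and `λ`, one has `ν + 2λ ≤ 2·2^n − 2^n/n`, stated in the
equivalent form `n·(ν + 2λ) ≤ 2n·2^n − 2^n`. -/
theorem stmt_16 (n : ℕ) (hn : 2 ≤ n) (l : List (Finset ℕ)) (hl : IsHamPath n l)
    (bs : List (List ℕ)) (hbs : IsRunPartition (n - 1) (flipSeq l) bs) :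
    n * (runNu (n - 1) bs + 2 * runLambda (n - 1) bs) ≤ 2 * n * 2 ^ n - 2 ^ n := by
  have hlen : (flipSeq l).length ≤ 2 ^ n := by
    simp [flipSeq, hl.2.2.1]
  obtain ⟨hflat, hblocks⟩ := hbs
  calc n * (runNu (n - 1) bs + 2 * runLambda (n - 1) bs)
      ≤ (2 * n - 1) * bs.flatten.length :=
        mul_runNu_add_runLambda_le (by omega) (Nat.sub_le n 1) bs hblocks fun a ha =>
          one_le_of_mem_flipSeq hl (hflat ▸ ha)
    _ ≤ (2 * n - 1) * 2 ^ n := Nat.mul_le_mul_left _ (hflat ▸ hlen)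
    _ = 2 * n * 2 ^ n - 2 ^ n := by rw [Nat.sub_mul, one_mul]
end
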